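/- Let Γ be an h-colored graph with vertex set V = V_1 ∪ ... ∪ V_h (disjoint color classes, no edge within a class) such that (1) each V_i has at least two elements, and (2) for any choice of 2(h−1) vertices u^1, ..., u^{2(h−1)} in V − V_i there exist two vertices v, w ∈ V_i adjacent to every u^j. Then the flag complex K(Γ) is homotopy equivalent to a wedge of (h−1)-spheres. -/

import Mathlib

open Pointwise

namespace PeiPaper

/-- Points of the face of the standard orthant spanned by the canonical basis vectors in `Y`. -/
def stdFace (N : ℕ) (Y : Finset (Fin N)) : Set (Fin N → ℤ) :=
  {v | (∀ i, 0 ≤ v i) ∧ ∀ i, i ∉ Y → v i = 0}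

/-- Integral orthogonal matrix. -/
def IsOrthMat {N : ℕ} (A : Matrix (Fin N) (Fin N) ℤ) : Prop :=
  A * A.transpose = 1

/-- `L` is an integral orthant of rank `k` in `ℤ^N`: an affine-orthogonal image of a
rank-`k` face of the standard orthant. -/
def IsOrthantOfRank {N : ℕ} (L : Set (Fin N → ℤ)) (k : ℕ) : Prop :=
  ∃ (a : Fin N → ℤ) (A : Matrix (Fin N) (Fin N) ℤ) (Y : Finset (Fin N)),
    IsOrthMat A ∧ Y.card = k ∧ L = (fun v => a + A.mulVec v) '' stdFace N Y

def IsOrthant {N : ℕ} (L : Set (Fin N → ℤ)) : Prop := ∃ k, IsOrthantOfRank L k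

/-- `S` is orthohedral: a finite union of integral orthants. -/
def IsOrthohedral {N : ℕ} (S : Set (Fin N → ℤ)) : Prop :=
  ∃ 𝓛 : Set (Set (Fin N → ℤ)), 𝓛.Finite ∧ (∀ L ∈ 𝓛, IsOrthant L) ∧ S = ⋃₀ 𝓛

/-- The rank of a set: the maximal rank of an orthant contained in it. -/
noncomputable def orthRank {N : ℕ} (S : Set (Fin N → ℤ)) : ℕ :=
  sSup {k | ∃ L, IsOrthantOfRank L k ∧ L ⊆ S}

/-- Commensurability: the intersection is nonempty and has the same rank as both sets. -/
def Commensurable {N : ℕ} (L L' : Set (Fin N → ℤ)) : Prop :=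
  (L ∩ L').Nonempty ∧ orthRank L = orthRank (L ∩ L') ∧ orthRank L' = orthRank (L ∩ L')

/-- The rank-`k` orthants contained in `S`. -/
def germSet {N : ℕ} (S : Set (Fin N → ℤ)) (k : ℕ) : Set (Set (Fin N → ℤ)) :=
  {L | IsOrthantOfRank L k ∧ L ⊆ S}

/-- The rank-`k` germs of `S`: commensurability classes of rank-`k` orthants of `S`. -/
def Germ {N : ℕ} (S : Set (Fin N → ℤ)) (k : ℕ) : Type _ :=
  Quot (fun L L' : germSet S k => Commensurable L.1 L'.1)

def germOf {N : ℕ} (S : Set (Fin N → ℤ)) (k : ℕ) (L : germSet S k) : Germ S k :=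
  Quot.mk _ L

/-- The number of rank-`k` germs of `S` (as a natural number; `0` if infinite). -/
noncomputable def heightAt {N : ℕ} (S : Set (Fin N → ℤ)) (k : ℕ) : ℕ :=
  Nat.card (Germ S k)

/-- The height of an orthohedral set: the number of germs of maximal rank. -/
noncomputable def height {N : ℕ} (S : Set (Fin N → ℤ)) : ℕ :=
  heightAt S (orthRank S)

/-- `f` is (the restriction of) an isometry of `ℤ^N` on `L`. -/
def IsometricOn {N : ℕ} (f : (Fin N → ℤ) → (Fin N → ℤ)) (L : Set (Fin N → ℤ)) : Prop :=
  ∃ (a : Fin N → ℤ) (A : Matrix (Fin N) (Fin N) ℤ),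
    IsOrthMat A ∧ ∀ x ∈ L, f x = a + A.mulVec x

/-- `f` is (the restriction of) a translation on `L`. -/
def TranslationOn {N : ℕ} (f : (Fin N → ℤ) → (Fin N → ℤ)) (L : Set (Fin N → ℤ)) : Prop :=
  ∃ a : Fin N → ℤ, ∀ x ∈ L, f x = a + x

/-- `f` is a piecewise-Euclidean-isometric map on `S`. -/
def IsPeiMapOn {N : ℕ} (S : Set (Fin N → ℤ)) (f : (Fin N → ℤ) → (Fin N → ℤ)) : Prop :=
  ∃ 𝓛 : Set (Set (Fin N → ℤ)), 𝓛.Finite ∧ (∀ L ∈ 𝓛, IsOrthant L) ∧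
    S = ⋃₀ 𝓛 ∧ 𝓛.PairwiseDisjoint id ∧ ∀ L ∈ 𝓛, IsometricOn f L

/-- `f` is a piecewise-Euclidean-translation map on `S`. -/
def IsPetMapOn {N : ℕ} (S : Set (Fin N → ℤ)) (f : (Fin N → ℤ) → (Fin N → ℤ)) : Prop :=
  ∃ 𝓛 : Set (Set (Fin N → ℤ)), 𝓛.Finite ∧ (∀ L ∈ 𝓛, IsOrthant L) ∧
    S = ⋃₀ 𝓛 ∧ 𝓛.PairwiseDisjoint id ∧ ∀ L ∈ 𝓛, TranslationOn f L

def IsPeiIso {N : ℕ} (S S' : Set (Fin N → ℤ)) (f : (Fin N → ℤ) → (Fin N → ℤ)) : Prop :=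
  IsPeiMapOn S f ∧ Set.InjOn f S ∧ f '' S = S'

def PeiIsomorphic {N : ℕ} (S S' : Set (Fin N → ℤ)) : Prop := ∃ f, IsPeiIso S S' f

def IsPetIso {N : ℕ} (S S' : Set (Fin N → ℤ)) (f : (Fin N → ℤ) → (Fin N → ℤ)) : Prop :=
  IsPetMapOn S f ∧ Set.InjOn f S ∧ f '' S = S'

def PetIsomorphic {N : ℕ} (S S' : Set (Fin N → ℤ)) : Prop := ∃ f, IsPetIso S S' f

/-- A pei-permutation of `S`: a permutation of `ℤ^N` supported on `S` which is pei on `S`. -/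
def IsPeiPerm {N : ℕ} (S : Set (Fin N → ℤ)) (g : Equiv.Perm (Fin N → ℤ)) : Prop :=
  IsPeiMapOn S ⇑g ∧ ∀ x ∉ S, g x = x

/-- The element `g` has rank at most `k`: it is supported on an orthohedral set of rank `≤ k`. -/
def rankLE {N : ℕ} (g : Equiv.Perm (Fin N → ℤ)) (k : ℕ) : Prop :=
  ∃ T : Set (Fin N → ℤ), IsOrthohedral T ∧ orthRank T ≤ k ∧ ∀ x ∉ T, g x = x

/-- `g` fixes every rank-`k` germ of `S`. -/
def FixesGerm {N : ℕ} (S : Set (Fin N → ℤ)) (k : ℕ) (g : Equiv.Perm (Fin N → ℤ)) : Prop :=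
  ∀ L, IsOrthantOfRank L k → L ⊆ S →
    ∃ L', IsOrthantOfRank L' k ∧ L' ⊆ L ∧ Commensurable L L' ∧
      IsometricOn (⇑g) L' ∧ Commensurable (⇑g '' L') L

/-- `g` fixes every rank-`k` germ of `S` and acts on its tangent coset by a translation. -/
def TranslatesGerm {N : ℕ} (S : Set (Fin N → ℤ)) (k : ℕ) (g : Equiv.Perm (Fin N → ℤ)) : Prop :=
  ∀ L, IsOrthantOfRank L k → L ⊆ S →
    ∃ L' a, IsOrthantOfRank L' k ∧ L' ⊆ L ∧ Commensurable L L' ∧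
      (∀ x ∈ L', g x = a + x) ∧ Commensurable (⇑g '' L') L

/-- `σ` is the map induced by `g` on the rank-`k` germs of `S`. -/
def InducesGermMap {N : ℕ} (S : Set (Fin N → ℤ)) (k : ℕ) (g : Equiv.Perm (Fin N → ℤ))
    (σ : Germ S k → Germ S k) : Prop :=
  ∀ L : germSet S k, ∃ (L'' : Set (Fin N → ℤ)) (M : germSet S k),
    IsOrthantOfRank L'' k ∧ L'' ⊆ L.1 ∧ Commensurable L.1 L'' ∧
    M.1 = ⇑g '' L'' ∧ σ (germOf S k L) = germOf S k M

/-- A finitary permutation which is even (has sign `1` on a finite invariant subset). -/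
def IsEvenFinitary {α : Type*} (σ : Equiv.Perm α) : Prop :=
  ∃ (F : Finset α) (σF : Equiv.Perm F),
    (∀ a ∉ F, σ a = a) ∧ (∀ a : F, σ (a : α) = (σF a : α)) ∧
    @Equiv.Perm.sign F (Classical.decEq _) inferInstance σF = 1

/-- `g` induces an even finitary permutation on the rank-`k` germs of `S`. -/
def IsEvenOnGerms {N : ℕ} (S : Set (Fin N → ℤ)) (k : ℕ) (g : Equiv.Perm (Fin N → ℤ)) : Prop :=
  ∃ σ : Equiv.Perm (Germ S k), InducesGermMap S k g ⇑σ ∧ IsEvenFinitary σ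

/-- Ordering of germs (of arbitrary ranks): `p ≤ q` if they have representatives `L ⊆ L'`. -/
def germLE {N : ℕ} (S : Set (Fin N → ℤ)) (p q : Σ k, Germ S k) : Prop :=
  ∃ (L : germSet S p.1) (L' : germSet S q.1),
    germOf S p.1 L = p.2 ∧ germOf S q.1 L' = q.2 ∧ L.1 ⊆ L'.1

/-- A maximal germ of `S`. -/
def IsMaxGerm {N : ℕ} (S : Set (Fin N → ℤ)) (p : Σ k, Germ S k) : Prop :=
  ∀ q, germLE S p q → germLE S q p

/-- A `0`-based orthant. -/
def IsBasedOrthant {N : ℕ} (L0 : Set (Fin N → ℤ)) : Prop :=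
  ∃ (A : Matrix (Fin N) (Fin N) ℤ) (Y : Finset (Fin N)),
    IsOrthMat A ∧ L0 = (fun v => A.mulVec v) '' stdFace N Y

/-- Two (oriented) parallel orthants. -/
def ParallelOrthants {N : ℕ} (L L' : Set (Fin N → ℤ)) : Prop :=
  ∃ a : Fin N → ℤ, L' = a +ᵥ L

/-- The indicator image `S_τ` of `S`: the union of the `0`-based parallel translates of
the orthants contained in `S`. -/
def indicatorImage {N : ℕ} (S : Set (Fin N → ℤ)) : Set (Fin N → ℤ) :=
  ⋃₀ {L0 | IsBasedOrthant L0 ∧ ∃ a : Fin N → ℤ, (a +ᵥ L0) ⊆ S}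

/-- The height function `h_S`: the number of maximal germs of `S` whose indicator is `L0`. -/
noncomputable def hFun {N : ℕ} (S : Set (Fin N → ℤ)) (L0 : Set (Fin N → ℤ)) : ℕ :=
  Nat.card {p : Σ k, Germ S k //
    IsMaxGerm S p ∧ ∃ L : germSet S p.1, germOf S p.1 L = p.2 ∧ ∃ a : Fin N → ℤ, L.1 = a +ᵥ L0}

/-- `S` is quasi-normal: the maximal based orthants of `S_τ` are exactly the support of `h_S`. -/
def QuasiNormal {N : ℕ} (S : Set (Fin N → ℤ)) : Prop :=
  ∀ L0 : Set (Fin N → ℤ),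
    (IsBasedOrthant L0 ∧ L0 ⊆ indicatorImage S ∧
      ∀ L1, IsBasedOrthant L1 → L1 ⊆ indicatorImage S → L0 ⊆ L1 → L1 ⊆ L0)
    ↔ (IsBasedOrthant L0 ∧ 0 < hFun S L0)

/-- The germ `q` of `S'` is the image of the germ `p` of `S` under the injective pei-map `f`. -/
def GermMapsTo {N : ℕ} (f : (Fin N → ℤ) → (Fin N → ℤ)) (S S' : Set (Fin N → ℤ))
    (p : Σ k, Germ S k) (q : Σ k, Germ S' k) : Prop :=
  p.1 = q.1 ∧ ∃ (L : germSet S p.1) (L'' : Set (Fin N → ℤ)) (M : germSet S' q.1),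
    germOf S p.1 L = p.2 ∧ IsOrthantOfRank L'' p.1 ∧ L'' ⊆ L.1 ∧ Commensurable L.1 L'' ∧
    M.1 = f '' L'' ∧ germOf S' q.1 M = q.2

/-- A stack of `h` parallel rank-`n` orthants. -/
def IsStack {N : ℕ} (S : Set (Fin N → ℤ)) (n h : ℕ) : Prop :=
  ∃ (L0 : Set (Fin N → ℤ)) (a : Fin h → (Fin N → ℤ)),
    IsOrthantOfRank L0 n ∧
    (Pairwise fun i j => Disjoint (a i +ᵥ L0) (a j +ᵥ L0)) ∧
    S = ⋃ i, a i +ᵥ L0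

/-- A coordinate half-space of `ℤ^N`. -/
def IsHalfSpace {N : ℕ} (H : Set (Fin N → ℤ)) : Prop :=
  ∃ (i : Fin N) (c : ℤ), H = {x | x i ≤ c} ∨ H = {x | c ≤ x i}

/-- The canonical embedding `ℤ^N → ℤ^{N+1}`. -/
def emb (N : ℕ) (x : Fin N → ℤ) : Fin (N + 1) → ℤ :=
  fun i => if h : (i : ℕ) < N then x ⟨i, h⟩ else 0

/-- The sum of all matrix entries of a finitely supported family of vectors. -/
noncomputable def totalSum (k : ℕ) (Γ : Type*) : (Γ →₀ (Fin k → ℤ)) →+ ℤ :=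
  Finsupp.liftAddHom (fun _ => ∑ i : Fin k, Pi.evalAddMonoidHom (fun _ => ℤ) i)

/-- The clique (flag) complex of a graph. -/
def cliqueComplex {V : Type*} (G : SimpleGraph V) : Set (Finset V) :=
  {s | s.Nonempty ∧ G.IsClique (s : Set V)}

/-- The geometric realization of a simplicial complex on vertex set `V`. -/
def realization {V : Type*} (K : Set (Finset V)) : Set (V → ℝ) :=
  {f | (∀ v, 0 ≤ f v) ∧ ∃ s ∈ K, Function.support f ⊆ ↑s ∧ ∑ v ∈ s, f v = 1}

/-- A wedge (bouquet) of `n`-spheres indexed by `ι`, with basepoint `b`. -/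
noncomputable def wedgeSpheres (ι : Type) (n : ℕ)
    (b : Metric.sphere (0 : EuclideanSpace ℝ (Fin (n + 1))) 1) : Type :=
  Quot (fun p q : Unit ⊕ (ι × Metric.sphere (0 : EuclideanSpace ℝ (Fin (n + 1))) 1) =>
    (Sum.elim (fun _ => True) (fun pr => pr.2 = b) p) ∧
    (Sum.elim (fun _ => True) (fun qr => qr.2 = b) q))

noncomputable instance (ι : Type) (n : ℕ) (b : Metric.sphere (0 : EuclideanSpace ℝ (Fin (n + 1))) 1) :
    TopologicalSpace (wedgeSpheres ι n b) :=
  letI : TopologicalSpace ι := ⊥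
  instTopologicalSpaceQuot

section Realization

open Set Topology unitInterval

/-- The open standard simplex is homeomorphic to Euclidean space via logarithmic ratios. -/
noncomputable def openSimplexHomeo (n : ℕ) :
    {x : stdSimplex ℝ (Fin (n + 1)) // ∀ i, 0 < x.1 i} ≃ₜ (Fin n → ℝ) where
  toFun x i := Real.log (x.1.1 i.succ) - Real.log (x.1.1 0)
  invFun y := ⟨⟨fun i => Real.exp (Fin.cons (α := fun _ => ℝ) 0 y i) /
      ∑ j, Real.exp (Fin.cons (α := fun _ => ℝ) 0 y j), fun i => by positivity, by
        rw [← Finset.sum_div]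
        exact div_self (by positivity)⟩, fun i => by
          simp only
          positivity⟩
  left_inv x := by
    have h0 := x.2 0
    have key : ∀ i, Real.exp (Fin.cons (α := fun _ => ℝ) 0
        (fun i : Fin n => Real.log (x.1.1 i.succ) - Real.log (x.1.1 0)) i)
        = x.1.1 i / x.1.1 0 := by
      intro i
      refine Fin.cases ?_ (fun j => ?_) i
      · simp [h0.ne']
      · have hj := x.2 j.succ
        simp [Real.exp_sub, Real.exp_log h0, Real.exp_log hj]
    refine Subtype.ext (Subtype.ext (funext fun i => ?_))
    show _ / _ = _
    rw [Finset.sum_congr rfl (fun j _ => key j), key, ← Finset.sum_div, x.1.2.2]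
    field_simp
  right_inv y := by
    ext i
    simp only
    rw [Real.log_div (by positivity) (by positivity), Real.log_div (by positivity) (by positivity)]
    simp
  continuous_toFun := by
    have hc : ∀ i, Continuous fun x : {x : stdSimplex ℝ (Fin (n + 1)) // ∀ i, 0 < x.1 i} =>
        x.1.1 i := fun i =>
      (continuous_apply i).comp (continuous_subtype_val.comp continuous_subtype_val)
    exact continuous_pi fun i => ((hc _).log fun x => (x.2 _).ne').sub
      ((hc _).log fun x => (x.2 _).ne')
  continuous_invFun := by
    refine Continuous.subtype_mk (Continuous.subtype_mk (continuous_pi fun i => ?_) _) _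
    have hc : ∀ i, Continuous fun y : Fin n → ℝ => Fin.cons (α := fun _ => ℝ) 0 y i := by
      intro i
      refine Fin.cases ?_ (fun j => ?_) i
      · simpa using continuous_const
      · simpa using continuous_apply j
    refine Continuous.div ((hc i).rexp) (continuous_finsetSum _ fun j _ => (hc j).rexp) ?_
    intro y
    positivity

/-- Collapsing the complement of an open subset to the point at infinity is continuous. -/
lemma continuous_collapse {X : Type*} [TopologicalSpace X] [T2Space X] {p : X → Prop}
    [DecidablePred p] (hp : IsOpen {x | p x}) :
    Continuous fun x : X => if h : p x then ((⟨x, h⟩ : {x // p x}) : OnePoint {x // p x})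
      else OnePoint.infty := by
  rw [continuous_def]
  intro s hs
  by_cases hinf : OnePoint.infty ∈ s
  · obtain ⟨-, hK⟩ := (OnePoint.isOpen_iff_of_mem hinf).1 hs
    have hc : IsClosed (Subtype.val '' ((OnePoint.some ⁻¹' s)ᶜ : Set {x // p x})) :=
      (hK.image continuous_subtype_val).isClosed
    convert hc.isOpen_compl using 1
    ext x
    by_cases h : p x <;> simp [h, hinf]
  · have ho := (OnePoint.isOpen_iff_of_notMem hinf).1 hs
    convert hp.isOpenMap_subtype_val _ ho using 1
    ext x
    by_cases h : p x <;> simp [h, hinf]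

/-- A sphere is a simplex with its boundary collapsed to a point. -/
lemma exists_simplex_to_sphere (n : ℕ) :
    ∃ (b : Metric.sphere (0 : EuclideanSpace ℝ (Fin (n + 1))) 1)
      (ψ : stdSimplex ℝ (Fin (n + 1)) → Metric.sphere (0 : EuclideanSpace ℝ (Fin (n + 1))) 1),
      Continuous ψ ∧ (∀ x, ψ x = b ↔ ∃ i, x.1 i = 0) ∧ (∀ y, y ≠ b → ∃ x, ψ x = y) ∧
      ∀ x y, ψ x = ψ y → ψ x ≠ b → x = y := by
  classical
  let p : stdSimplex ℝ (Fin (n + 1)) → Prop := fun x => ∀ i, 0 < x.1 i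
  have hp : IsOpen {x | p x} := by
    simp only [p, ofPred_forall]
    exact isOpen_iInter_of_finite fun i => isOpen_lt continuous_const
      ((continuous_apply i).comp continuous_subtype_val)
  let e : OnePoint {x // p x} ≃ₜ Metric.sphere (0 : EuclideanSpace ℝ (Fin (n + 1))) 1 :=
    (openSimplexHomeo n).onePointCongr.trans (onePointEquivSphereOfFinrankEq (by simp))
  have hb : ∀ x, (e (if h : p x then ((⟨x, h⟩ : {x // p x}) : OnePoint {x // p x})
      else OnePoint.infty) = e OnePoint.infty) ↔ ¬ p x := by
    intro x
    by_cases h : p x <;> simp [h]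
  refine ⟨e OnePoint.infty, fun x => e (if h : p x then ((⟨x, h⟩ : {x // p x}) :
    OnePoint {x // p x}) else OnePoint.infty), e.continuous.comp (continuous_collapse hp),
    fun x => ?_, fun y hy => ?_, fun x y hxy hx => ?_⟩
  · rw [hb]
    simp only [p, not_forall, not_lt]
    exact exists_congr fun i => ⟨fun h => le_antisymm h (x.2.1 i), fun h => h.le⟩
  · obtain ⟨z, rfl⟩ := e.surjective y
    induction z with
    | infty => exact absurd rfl hy
    | coe z => exact ⟨z.1, by simp [z.2]⟩
  · have h1 : p x := by
      by_contra h
      exact hx ((hb x).2 h)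
    have h2 : p y := by
      by_contra h
      exact hx (hxy.trans ((hb y).2 h))
    simpa [h1, h2] using hxy

/-- A set of finite vertex sets is an abstract simplicial complex. -/
structure IsAbstractComplex {V : Type*} (K : Set (Finset V)) : Prop where
  nonempty : ∀ s ∈ K, s.Nonempty
  down_closed : ∀ s ∈ K, ∀ t ⊆ s, t.Nonempty → t ∈ K

section Complexes

variable {V : Type*} {K L : Set (Finset V)}

lemma realization_mono (h : K ⊆ L) : realization K ⊆ realization L :=
  fun _ hx => ⟨hx.1, let ⟨s, hs, h1⟩ := hx.2; ⟨s, h hs, h1⟩⟩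

lemma mem_realization {x : V → ℝ} {s : Finset V} (hs : s ∈ K) (h0 : ∀ v, 0 ≤ x v)
    (hx : ∀ v ∉ s, x v = 0) (h1 : ∑ v ∈ s, x v = 1) : x ∈ realization K :=
  ⟨h0, s, hs, fun v hv => by_contra fun h => hv (hx v h), h1⟩

lemma finite_support {x : V → ℝ} (hx : x ∈ realization K) : (Function.support x).Finite := by
  obtain ⟨-, s, -, h, -⟩ := hx
  exact s.finite_toSet.subset h

lemma sum_eq_one {x : V → ℝ} (hx : x ∈ realization K) {s : Finset V} (hs : ∀ v ∉ s, x v = 0) :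
    ∑ v ∈ s, x v = 1 := by
  classical
  obtain ⟨-, t, -, h, h1⟩ := hx
  rw [Finset.sum_subset (Finset.subset_union_left (s₁ := s) (s₂ := t)) fun v _ hv => hs v hv, ← h1]
  refine (Finset.sum_subset Finset.subset_union_right fun v _ hv => ?_).symm
  by_contra h2
  exact hv (h h2)

/-- The vertices with nonzero barycentric coordinate. -/
noncomputable def supp (x : realization K) : Finset V := (finite_support x.2).toFinset

lemma mem_supp {x : realization K} {v : V} : v ∈ supp x ↔ x.1 v ≠ 0 := by
  simp [supp]

lemma notMem_supp {x : realization K} {v : V} : v ∉ supp x ↔ x.1 v = 0 := by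
  simp [supp]

lemma sum_supp (x : realization K) : ∑ v ∈ supp x, x.1 v = 1 :=
  sum_eq_one x.2 fun _ h => notMem_supp.1 h

lemma supp_nonempty (x : realization K) : (supp x).Nonempty := by
  by_contra h
  have := sum_supp x
  simp [Finset.not_nonempty_iff_eq_empty.1 h] at this

lemma supp_subset {x : realization K} {s : Finset V} (hs : ∀ v ∉ s, x.1 v = 0) : supp x ⊆ s :=
  fun v hv => by_contra fun h => mem_supp.1 hv (hs v h)

lemma supp_mem (hK : IsAbstractComplex K) (x : realization K) : supp x ∈ K := by
  obtain ⟨-, s, hs, h, -⟩ := x.2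
  exact hK.down_closed s hs _ (supp_subset fun v hv => by_contra fun h' => hv (h h'))
    (supp_nonempty x)

lemma coord_nonneg (x : realization K) (v : V) : 0 ≤ x.1 v := x.2.1 v

lemma mem_realization_of_supp_mem {x : realization K} (h : supp x ∈ L) : x.1 ∈ realization L :=
  mem_realization h (coord_nonneg x) (fun _ h => notMem_supp.1 h) (sum_supp x)

lemma supp_mem_iff (hL : IsAbstractComplex L) {x : realization K} :
    supp x ∈ L ↔ x.1 ∈ realization L := by
  refine ⟨mem_realization_of_supp_mem, fun h => ?_⟩
  have := supp_mem hL ⟨x.1, h⟩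
  exact this

lemma continuous_coord (v : V) : Continuous fun x : realization K => x.1 v :=
  (continuous_apply v).comp continuous_subtype_val

lemma continuous_to_realization {Y : Type*} [TopologicalSpace Y] {f : Y → realization K}
    (h : ∀ v, Continuous fun y => (f y).1 v) : Continuous f :=
  Continuous.subtype_mk (continuous_pi h) _

lemma continuousOn_to_realization {Y : Type*} [TopologicalSpace Y] {f : Y → realization K}
    {S : Set Y} (h : ∀ v, ContinuousOn (fun y => (f y).1 v) S) : ContinuousOn f S := by
  rw [continuousOn_iff_continuous_domRestrict]
  exact continuous_to_realization fun v => continuousOn_iff_continuous_domRestrict.1 (h v)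

lemma segment_mem_realization {x y : realization K} {s : Finset V} (hs : s ∈ K)
    (hx : ∀ v ∉ s, x.1 v = 0) (hy : ∀ v ∉ s, y.1 v = 0) (t : I) :
    (fun v => (1 - t.1) * x.1 v + t.1 * y.1 v) ∈ realization K := by
  refine mem_realization hs (fun v => ?_) (fun v hv => by simp [hx v hv, hy v hv]) ?_
  · have := coord_nonneg x v
    have := coord_nonneg y v
    have := t.2.1
    have : 0 ≤ 1 - t.1 := sub_nonneg.2 t.2.2
    positivity
  · rw [Finset.sum_add_distrib, ← Finset.mul_sum, ← Finset.mul_sum, sum_eq_one x.2 hx,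
      sum_eq_one y.2 hy]
    ring

/-- Maps into a complex that are pointwise contained in a common simplex are homotopic. -/
lemma homotopic_of_common_face {Y : Type*} [TopologicalSpace Y] (f g : C(Y, realization K))
    (h : ∀ y, ∃ s ∈ K, (∀ v ∉ s, (f y).1 v = 0) ∧ ∀ v ∉ s, (g y).1 v = 0) : f.Homotopic g := by
  refine ⟨⟨⟨fun p => ⟨fun v => (1 - p.1.1) * (f p.2).1 v + p.1.1 * (g p.2).1 v, ?_⟩, ?_⟩, ?_, ?_⟩⟩
  · obtain ⟨s, hs, h1, h2⟩ := h p.2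
    exact segment_mem_realization hs h1 h2 p.1
  · refine continuous_to_realization fun v => ?_
    have h1 := (continuous_coord v).comp (f.continuous.comp (continuous_snd (X := I)))
    have h2 := (continuous_coord v).comp (g.continuous.comp (continuous_snd (X := I)))
    have h3 : Continuous fun p : I × Y => p.1.1 := continuous_subtype_val.comp continuous_fst
    exact ((continuous_const.sub h3).mul h1).add (h3.mul h2)
  · intro y
    ext v
    simp
  · intro y
    ext v
    simp

/-- A self-map of a complex of bounded dimension sending a neighbourhood of each point into the
closed simplex carrying that point. -/
structure IsClip (ε : ℝ) (e : realization K → realization K) : Prop where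
  pos : 0 < ε
  continuous : Continuous e
  lt_of_ne_zero : ∀ x v, (e x).1 v ≠ 0 → ε < x.1 v
  eventually : ∀ x₀, ∀ᶠ x in 𝓝 x₀, ∀ v, x₀.1 v = 0 → (e x).1 v = 0

lemma exists_clip (hK : IsAbstractComplex K) {D : ℕ} (hD : ∀ s ∈ K, s.card ≤ D) :
    ∃ (ε : ℝ) (e : realization K → realization K), IsClip ε e := by
  classical
  obtain ⟨ε, hε, hDε⟩ : ∃ ε : ℝ, 0 < ε ∧ D * ε ≤ 1 / 2 := by
    refine ⟨1 / (2 * (D + 1)), by positivity, ?_⟩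
    rw [mul_one_div, div_le_div_iff₀ (by positivity) (by positivity)]
    linarith
  let w : realization K → ℝ := fun x => ∑ u ∈ supp x, max 0 (x.1 u - ε)
  have hw : ∀ x, 0 < w x := by
    intro x
    have h1 : ∑ u ∈ supp x, (x.1 u - ε) ≤ w x :=
      Finset.sum_le_sum fun u _ => le_max_right _ _
    rw [Finset.sum_sub_distrib, sum_supp, Finset.sum_const, nsmul_eq_mul] at h1
    have h2 : ((supp x).card : ℝ) * ε ≤ D * ε := by
      have := hD _ (supp_mem hK x)
      gcongr
    linarith
  let e : realization K → realization K := fun x =>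
    ⟨fun v => max 0 (x.1 v - ε) / w x, mem_realization (supp_mem hK x)
      (fun v => div_nonneg (le_max_left _ _) (hw x).le)
      (fun v hv => by simp [notMem_supp.1 hv, hε.le])
      (by rw [← Finset.sum_div]; exact div_self (hw x).ne')⟩
  have hsmall : ∀ x₀ : realization K, ∀ᶠ x in 𝓝 x₀, ∀ v, x₀.1 v = 0 → x.1 v < ε := by
    intro x₀
    have h1 : Continuous fun x : realization K => ∑ v ∈ supp x₀, x.1 v :=
      continuous_finsetSum _ fun v _ => continuous_coord v
    have h2 := h1.continuousAt.eventually (lt_mem_nhds (a := 1 - ε) (by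
      show 1 - ε < ∑ v ∈ supp x₀, x₀.1 v
      rw [sum_supp]; linarith))
    filter_upwards [h2] with x hx v hv
    have h3 : ∑ u ∈ insert v (supp x₀ ), x.1 u ≤ ∑ u ∈ supp x ∪ insert v (supp x₀), x.1 u :=
      Finset.sum_le_sum_of_subset_of_nonneg Finset.subset_union_right
        fun u _ _ => coord_nonneg x u
    rw [Finset.sum_insert (notMem_supp.2 hv), sum_eq_one x.2 (s := supp x ∪ _)] at h3
    · linarith
    · intro u hu
      exact notMem_supp.1 fun h => hu (Finset.mem_union_left _ h)
  refine ⟨ε, e, hε, ?_, ?_, ?_⟩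
  · have hwc : Continuous w := by
      refine continuous_iff_continuousAt.2 fun x₀ => ?_
      have h1 : Continuous fun x : realization K => ∑ u ∈ supp x₀, max 0 (x.1 u - ε) :=
        continuous_finsetSum _ fun v _ =>
          continuous_const.max ((continuous_coord v).sub continuous_const)
      refine h1.continuousAt.congr ?_
      filter_upwards [hsmall x₀] with x hx
      show _ = ∑ u ∈ supp x, _
      rw [Finset.sum_subset (Finset.subset_union_left (s₂ := supp x)),
        Finset.sum_subset (Finset.subset_union_right (s₁ := supp x₀) (s₂ := supp x))]
      · intro u _ hu
        simp [notMem_supp.1 hu, hε.le]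
      · intro u _ hu
        simpa using (hx u (notMem_supp.1 hu)).le
    exact continuous_to_realization fun v =>
      (continuous_const.max ((continuous_coord v).sub continuous_const)).div hwc
        fun x => (hw x).ne'
  · intro x v h
    by_contra hlt
    refine h ?_
    show max 0 (x.1 v - ε) / w x = 0
    rw [max_eq_left (by linarith), zero_div]
  · intro x₀
    filter_upwards [hsmall x₀] with x hx v hv
    show max 0 (x.1 v - ε) / w x = 0
    rw [max_eq_left (by linarith [hx v hv]), zero_div]

namespace IsClip

variable {ε : ℝ} {e : realization K → realization K}

lemma eq_zero (he : IsClip ε e) {x : realization K} {v : V} (h : x.1 v = 0) : (e x).1 v = 0 := by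
  by_contra h'
  linarith [he.lt_of_ne_zero x v h', he.pos]

lemma supp_subset (he : IsClip ε e) (x : realization K) : supp (e x) ⊆ supp x :=
  PeiPaper.supp_subset fun _ hv => he.eq_zero (notMem_supp.1 hv)

/-- Precomposing a map that is continuous on closed simplices with a clip makes it continuous. -/
lemma continuous_comp (he : IsClip ε e) (hK : IsAbstractComplex K) {P Z : Type*}
    [TopologicalSpace P] [TopologicalSpace Z] {φ : realization K × P → Z}
    (hφ : ∀ s ∈ K, ContinuousOn φ {p | ∀ v ∉ s, p.1.1 v = 0}) :
    Continuous fun p : realization K × P => φ (e p.1, p.2) := by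
  refine continuous_iff_continuousAt.2 fun ⟨x₀, t₀⟩ => ?_
  have h1 := hφ _ (supp_mem hK x₀) (e x₀, t₀) fun v hv => he.eq_zero (notMem_supp.1 hv)
  refine h1.tendsto.comp (tendsto_nhdsWithin_iff.2 ⟨?_, ?_⟩)
  · exact ((he.continuous.comp continuous_fst).prodMk continuous_snd).continuousAt
  · filter_upwards [continuous_fst.continuousAt.eventually (he.eventually x₀)] with p hp v hv
    exact hp v (notMem_supp.1 hv)

/-- The version of `IsClip.continuous_comp` without parameters. -/
lemma continuous_comp' (he : IsClip ε e) (hK : IsAbstractComplex K) {Z : Type*}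
    [TopologicalSpace Z] {φ : realization K → Z}
    (hφ : ∀ s ∈ K, ContinuousOn φ {x | ∀ v ∉ s, x.1 v = 0}) :
    Continuous fun x => φ (e x) :=
  (he.continuous_comp hK (P := Unit) (φ := fun p => φ p.1) fun s hs =>
    (hφ s hs).comp continuousOn_fst fun _ hp => hp).comp (Continuous.prodMk_left ())

end IsClip

end Complexes

lemma exists_contraction (Z : Type*) [TopologicalSpace Z] [ContractibleSpace Z] :
    ∃ (p : Z) (H : Z × I → Z), Continuous H ∧ (∀ z, H (z, 0) = z) ∧ ∀ z, H (z, 1) = p := by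
  obtain ⟨p, ⟨F⟩⟩ := id_nullhomotopic Z
  exact ⟨p, fun q => F (q.2, q.1), F.continuous.comp continuous_swap, fun z => by simp,
    fun z => by simp⟩

section Cone

variable {V : Type*} {K M : Set (Finset V)}

open Classical in
/-- Radial projection of the closed star of `b`, away from the tip `b`, onto the link. -/
noncomputable def radial (b : V) (x : V → ℝ) (v : V) : ℝ :=
  if v = b then 0 else x v / max (1 / 2) (1 - x b)

/-- Twice the coordinate at `b`, truncated at `1`. -/
noncomputable def tipWeight (b : V) (x : realization K) : I :=
  ⟨min 1 (2 * x.1 b), le_min zero_le_one (mul_nonneg zero_le_two (coord_nonneg x b)),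
    min_le_left _ _⟩

lemma continuous_tipWeight (b : V) : Continuous (tipWeight (K := K) b) :=
  Continuous.subtype_mk (continuous_const.min (continuous_const.mul (continuous_coord b))) _

lemma tipWeight_eq_zero {b : V} {x : realization K} (h : x.1 b = 0) : tipWeight b x = 0 :=
  Subtype.ext (by simp [tipWeight, h])

lemma tipWeight_eq_one {b : V} {x : realization K} (h : 1 / 2 ≤ x.1 b) : tipWeight b x = 1 :=
  Subtype.ext (min_eq_left (by linarith))

open Classical in
lemma radial_mem {b : V} {s : Finset V} (hb : b ∈ s) (hs : s.erase b = ∅ ∨ s.erase b ∈ M)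
    {x : realization K} (hx : ∀ v ∉ s, x.1 v = 0) (hxb : x.1 b ≤ 1 / 2) :
    radial b x.1 ∈ realization M := by
  have h1 := sum_eq_one x.2 hx
  rw [← Finset.add_sum_erase _ _ hb] at h1
  have hm : max (1 / 2) (1 - x.1 b) = 1 - x.1 b := max_eq_right (by linarith)
  rcases hs with hs | hs
  · rw [hs, Finset.sum_empty] at h1
    linarith
  · refine mem_realization hs (fun v => ?_) (fun v hv => ?_) ?_
    · unfold radial
      split_ifs
      · exact le_rfl
      · have := coord_nonneg x v
        positivity
    · unfold radial
      split_ifs with h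
      · rfl
      · rw [hx v fun h' => hv (Finset.mem_erase.2 ⟨h, h'⟩), zero_div]
    · have h2 : ∀ v ∈ s.erase b, radial b x.1 v = x.1 v / (1 - x.1 b) := fun v hv => by
        rw [radial, if_neg (Finset.ne_of_mem_erase hv), hm]
      rw [Finset.sum_congr rfl h2, ← Finset.sum_div, div_eq_one_iff_eq (by linarith)]
      linarith

lemma continuous_radial (b v : V) : Continuous fun x : realization K => radial b x.1 v := by
  unfold radial
  split_ifs
  · exact continuous_const
  · exact (continuous_coord v).div
      (continuous_const.max (continuous_const.sub (continuous_coord b))) fun x =>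
        (lt_of_lt_of_le (by norm_num) (le_max_left _ _)).ne'

open Classical in
/-- The contraction of the link applied to the radial projection. -/
noncomputable def linkMap (b : V) (p : realization M) (H : realization M × I → realization M)
    (q : realization K × I) : realization M :=
  if h : radial b q.1.1 ∈ realization M ∧ q.1.1 b ≤ 1 / 2 then
    H (⟨_, h.1⟩, q.2 * tipWeight b q.1) else p

variable {b : V} {p : realization M} {H : realization M × I → realization M}

open Classical in
lemma continuousOn_linkMap (Hc : Continuous H) {s : Finset V} (hb : b ∈ s)
    (hs : s.erase b = ∅ ∨ s.erase b ∈ M) :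
    ContinuousOn (linkMap (K := K) b p H)
      {q | (∀ v ∉ s, q.1.1 v = 0) ∧ q.1.1 b ≤ 1 / 2} := by
  rw [continuousOn_iff_continuous_domRestrict]
  have h : ∀ q : {q : realization K × I | (∀ v ∉ s, q.1.1 v = 0) ∧ q.1.1 b ≤ 1 / 2},
      radial b q.1.1.1 ∈ realization M ∧ q.1.1.1 b ≤ 1 / 2 :=
    fun q => ⟨radial_mem hb hs q.2.1 q.2.2, q.2.2⟩
  have : Continuous fun q : {q : realization K × I | (∀ v ∉ s, q.1.1 v = 0) ∧ q.1.1 b ≤ 1 / 2} =>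
      H (⟨_, (h q).1⟩, q.1.2 * tipWeight b q.1.1) := by
    refine Hc.comp (Continuous.prodMk ?_ ?_)
    · exact continuous_to_realization fun v => (continuous_radial b v).comp
        (continuous_fst.comp continuous_subtype_val)
    · exact (continuous_snd.comp continuous_subtype_val).mul
        ((continuous_tipWeight b).comp (continuous_fst.comp continuous_subtype_val))
  refine this.congr fun q => ?_
  show _ = linkMap b p H q.1
  rw [linkMap, dif_pos (h q)]

lemma linkMap_one_of_le (H1 : ∀ z, H (z, 1) = p) {x : realization K} (h : 1 / 2 ≤ x.1 b) :
    linkMap b p H (x, 1) = p := by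
  unfold linkMap
  split_ifs
  · simp only [tipWeight_eq_one h, mul_one, H1]
  · rfl

open Classical in
lemma linkMap_of_mul_eq_zero (H0 : ∀ z, H (z, 0) = z) {s : Finset V} (hb : b ∈ s)
    (hs : s.erase b = ∅ ∨ s.erase b ∈ M) {x : realization K} (hx : ∀ v ∉ s, x.1 v = 0)
    (hxb : x.1 b ≤ 1 / 2) {t : I} (ht : t * tipWeight b x = 0) :
    (linkMap b p H (x, t)).1 = radial b x.1 := by
  rw [linkMap, dif_pos ⟨radial_mem hb hs hx hxb, hxb⟩]
  simp only [ht, H0]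

lemma radial_eq_self {x : realization K} (h : x.1 b = 0) : radial b x.1 = x.1 := by
  funext v
  unfold radial
  split_ifs with hv
  · rw [hv, h]
  · rw [h, max_eq_right (by norm_num)]
    simp

lemma isClosed_face (s : Finset V) : IsClosed {x : realization K | ∀ v ∉ s, x.1 v = 0} := by
  simp only [ofPred_forall]
  exact isClosed_iInter fun v => isClosed_iInter fun _ =>
    isClosed_eq (continuous_coord v) continuous_const

/-- A function on a closed simplex is continuous if it is so on both halves cut out by comparing
two continuous functions. -/
lemma continuousOn_of_le_of_ge {Y Z : Type*} [TopologicalSpace Y] [TopologicalSpace Z] {F : Set Y}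
    {φ : Y → Z} {f g : Y → ℝ} (hF : IsClosed F) (hf : ContinuousOn f F) (hg : ContinuousOn g F)
    (h1 : ContinuousOn φ {y | y ∈ F ∧ f y ≤ g y}) (h2 : ContinuousOn φ {y | y ∈ F ∧ g y ≤ f y}) :
    ContinuousOn φ F := by
  refine (h1.union_of_isClosed h2 (hF.isClosed_le hf hg) (hF.isClosed_le hg hf)).mono ?_
  exact fun y hy => (le_total (f y) (g y)).imp (fun h => ⟨hy, h⟩) fun h => ⟨hy, h⟩

end Cone

section Attach

variable {V : Type*}

open Classical in
/-- The value `f b` for some `b ∈ B` at which `x` does not vanish, and `a` if there is none. -/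
noncomputable def select {A : Type*} (B : Set V) (x : V → ℝ) (f : B → A) (a : A) : A :=
  if h : ∃ b : B, x b ≠ 0 then f h.choose else a

lemma select_eq_default {A : Type*} {B : Set V} {x : V → ℝ} (f : B → A) (a : A)
    (h : ∀ b : B, x b = 0) : select B x f a = a :=
  dif_neg fun ⟨b, hb⟩ => hb (h b)

lemma select_eq {A : Type*} {B : Set V} {x : V → ℝ} (f : B → A) (a : A) (b : B)
    (h : ∀ b' : B, x b' ≠ 0 → b' = b) (hb : x b = 0 → a = f b) : select B x f a = f b := by
  by_cases h0 : ∃ b : B, x b ≠ 0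
  · rw [select, dif_pos h0, h _ h0.choose_spec]
  · push Not at h0
    rw [select_eq_default f a h0, hb (h0 b)]

lemma select_cases {A : Type*} (B : Set V) (x : V → ℝ) (f : B → A) (a : A) :
    (∃ b, select B x f a = f b) ∨ (∀ b : B, x b = 0) ∧ select B x f a = a := by
  by_cases h0 : ∃ b : B, x b ≠ 0
  · exact Or.inl ⟨h0.choose, dif_pos h0⟩
  · push Not at h0
    exact Or.inr ⟨h0, select_eq_default f a h0⟩

open Classical in
/-- The point dividing the segment from `y` to the vertex `b`. -/
noncomputable def conePoint (b : V) (m : I) (y : V → ℝ) (v : V) : ℝ :=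
  m.1 * (if v = b then 1 else 0) + (1 - m.1) * y v

open Classical in
lemma conePoint_mem {K : Set (Finset V)} {b : V} {s : Finset V} (hs : insert b s ∈ K) (m : I)
    {y : V → ℝ} (hy : y ∈ realization {s}) : conePoint b m y ∈ realization K := by
  have hy0 : ∀ v ∉ s, y v = 0 := by
    obtain ⟨-, t, rfl, h, -⟩ := hy
    exact fun v hv => by_contra fun h' => hv (h h')
  refine mem_realization hs (fun v => ?_) (fun v hv => ?_) ?_
  · have := m.2.1
    have : 0 ≤ 1 - m.1 := sub_nonneg.2 m.2.2
    have := hy.1 v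
    unfold conePoint
    positivity
  · rw [Finset.mem_insert, not_or] at hv
    simp [conePoint, hv.1, hy0 v hv.2]
  · unfold conePoint
    rw [Finset.sum_add_distrib, ← Finset.mul_sum, ← Finset.mul_sum,
      sum_eq_one hy fun v hv => hy0 v fun h => hv (Finset.mem_insert_of_mem h)]
    simp

lemma mem_realization_singleton {K : Set (Finset V)} {y : V → ℝ} (hy : y ∈ realization K) :
    ∃ s ∈ K, y ∈ realization {s} := by
  obtain ⟨h0, s, hs, h⟩ := hy
  exact ⟨s, hs, h0, s, rfl, h⟩

lemma conePoint_zero (b : V) (y : V → ℝ) : conePoint b 0 y = y := by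
  funext v
  simp [conePoint]

lemma conePoint_one (b : V) (y z : V → ℝ) : conePoint b 1 y = conePoint b 1 z := by
  funext v
  simp [conePoint]

open Classical in
/-- Attaching cones over contractible subcomplexes to a contractible complex yields a contractible
complex. -/
lemma contractible_attach {X Y : Set (Finset V)} (hX : IsAbstractComplex X)
    {D : ℕ} (hD : ∀ s ∈ X, s.card ≤ D) (hYX : Y ⊆ X) (B : Set V) (L : B → Set (Finset V))
    (hBY : ∀ s ∈ Y, ∀ b ∈ B, b ∉ s) (hLY : ∀ b, L b ⊆ Y)
    (hXs : ∀ s ∈ X, s ∈ Y ∨ ∃ b : B, b.1 ∈ s ∧ (s.erase b = ∅ ∨ s.erase b ∈ L b))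
    (hLX : ∀ b, ∀ t ∈ L b, insert b.1 t ∈ X)
    (hcL : ∀ b, ContractibleSpace (realization (L b)))
    (hcY : ContractibleSpace (realization Y)) : ContractibleSpace (realization X) := by
  obtain ⟨ε, e, he⟩ := exists_clip hX hD
  choose p H Hc H0 H1 using fun b : B => exists_contraction (realization (L b))
  let k : B → realization X × I → V → ℝ := fun b q => (linkMap b.1 (p b) (H b) q).1
  have hk : ∀ b q, k b q ∈ realization (L b) := fun b q => (linkMap b.1 (p b) (H b) q).2
  let r : realization X → V → ℝ := fun x => select B x.1 (fun b => k b (x, 1)) x.1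
  let Ψ : realization X × I → V → ℝ := fun q =>
    select B q.1.1 (fun b => conePoint b.1 (tipWeight b.1 q.1) (k b q)) q.1.1
  have hrmem : ∀ x, r x ∈ realization Y := by
    intro x
    rcases select_cases B x.1 (fun b => k b (x, 1)) x.1 with ⟨b, hb⟩ | ⟨h0, hb⟩
    · simp only [r, hb]
      exact realization_mono (hLY b) (hk b _)
    · simp only [r, hb]
      refine mem_realization_of_supp_mem ((hXs _ (supp_mem hX x)).resolve_right ?_)
      rintro ⟨b, hb, -⟩
      exact mem_supp.1 hb (h0 b)
  have hΨmem : ∀ q, Ψ q ∈ realization X := by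
    intro q
    rcases select_cases B q.1.1 (fun b => conePoint b.1 (tipWeight b.1 q.1) (k b q)) q.1.1
      with ⟨b, hb⟩ | ⟨h0, hb⟩
    · simp only [Ψ, hb]
      obtain ⟨s, hs, h⟩ := mem_realization_singleton (hk b q)
      exact conePoint_mem (hLX b s hs) _ h
    · simp only [Ψ, hb]
      exact q.1.2
  have huniq : ∀ s ∈ X, ∀ b : B, (s.erase b = ∅ ∨ s.erase b ∈ L b) →
      ∀ x : realization X, (∀ v ∉ s, x.1 v = 0) → ∀ b' : B, x.1 b' ≠ 0 → b' = b := by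
    intro s _ b hs x hx b' hb'
    by_contra hne
    have h1 : b'.1 ∈ s.erase b :=
      Finset.mem_erase.2 ⟨fun h => hne (Subtype.ext h), by_contra fun h => hb' (hx _ h)⟩
    rcases hs with hs | hs
    · simp [hs] at h1
    · exact hBY _ (hLY b hs) b' b'.2 h1
  have hk0 : ∀ s ∈ X, ∀ b : B, b.1 ∈ s → (s.erase b = ∅ ∨ s.erase b ∈ L b) →
      ∀ x : realization X, (∀ v ∉ s, x.1 v = 0) → ∀ t, x.1 b = 0 → k b (x, t) = x.1 := by
    intro s _ b hb hs x hx t h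
    rw [← radial_eq_self h]
    exact linkMap_of_mul_eq_zero (H0 b) hb hs hx (by rw [h]; norm_num)
      (by rw [tipWeight_eq_zero h, mul_zero])
  have hr : ∀ s ∈ X, ∀ b : B, b.1 ∈ s → (s.erase b = ∅ ∨ s.erase b ∈ L b) →
      ∀ x : realization X, (∀ v ∉ s, x.1 v = 0) → r x = k b (x, 1) :=
    fun s hsX b hb hs x hx => select_eq _ _ b (huniq s hsX b hs x hx)
      fun h => (hk0 s hsX b hb hs x hx 1 h).symm
  have hΨ : ∀ s ∈ X, ∀ b : B, b.1 ∈ s → (s.erase b = ∅ ∨ s.erase b ∈ L b) →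
      ∀ x : realization X, (∀ v ∉ s, x.1 v = 0) → ∀ t,
        Ψ (x, t) = conePoint b.1 (tipWeight b.1 x) (k b (x, t)) :=
    fun s hsX b hb hs x hx t => select_eq _ _ b (huniq s hsX b hs x hx) fun h => by
      simp only [hk0 s hsX b hb hs x hx t h, tipWeight_eq_zero h, conePoint_zero]
  have hr0 : ∀ x : realization X, (∀ b : B, x.1 b = 0) → r x = x.1 :=
    fun x h => select_eq_default _ _ h
  have hΨ0 : ∀ q : realization X × I, (∀ b : B, q.1.1 b = 0) → Ψ q = q.1.1 :=
    fun q h => select_eq_default _ _ h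
  have hYr : ∀ s ∈ Y, ∀ x : realization X, (∀ v ∉ s, x.1 v = 0) → ∀ b : B, x.1 b = 0 :=
    fun s hs x hx b => hx _ (hBY s hs b b.2)
  have hrc : Continuous fun x => (⟨r (e x), hrmem _⟩ : realization Y) := by
    refine he.continuous_comp' hX (φ := fun x => (⟨r x, hrmem x⟩ : realization Y)) fun s hs => ?_
    refine continuousOn_to_realization fun v => ?_
    rcases hXs s hs with hY | ⟨b, hb, hbs⟩
    · exact (continuous_coord v).continuousOn.congr fun x hx =>
        congrFun (hr0 x (hYr s hY x hx)) v
    · refine ContinuousOn.congr (f := fun x => k b (x, 1) v) ?_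
        fun x hx => congrFun (hr s hs b hb hbs x hx) v
      refine continuousOn_of_le_of_ge (isClosed_face s) (continuous_coord b.1).continuousOn
        (g := fun _ => 1 / 2) continuousOn_const ?_ ?_
      · exact (continuous_coord v).comp_continuousOn ((continuousOn_linkMap (Hc b) hb hbs).comp
          (Continuous.prodMk_left (1 : I)).continuousOn fun x hx => hx)
      · refine (continuousOn_const (c := (p b).1 v)).congr fun x hx => ?_
        simp only [k]
        rw [linkMap_one_of_le (H1 b) hx.2]
  have hΨc : Continuous fun q : realization X × I =>
      (⟨Ψ (e q.1, q.2), hΨmem _⟩ : realization X) := by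
    refine he.continuous_comp hX (φ := fun q => (⟨Ψ q, hΨmem q⟩ : realization X)) fun s hs => ?_
    refine continuousOn_to_realization fun v => ?_
    have hcoord : ∀ v, Continuous fun q : realization X × I => q.1.1 v :=
      fun v => (continuous_coord v).comp continuous_fst
    rcases hXs s hs with hY | ⟨b, hb, hbs⟩
    · exact (hcoord v).continuousOn.congr fun q hq =>
        congrFun (hΨ0 q (hYr s hY q.1 hq)) v
    · have hw : Continuous fun q : realization X × I => (tipWeight b.1 q.1).1 :=
        continuous_subtype_val.comp ((continuous_tipWeight b.1).comp continuous_fst)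
      refine ContinuousOn.congr
        (f := fun q : realization X × I => conePoint b.1 (tipWeight b.1 q.1) (k b q) v) ?_
        fun q hq => congrFun (hΨ s hs b hb hbs q.1 hq q.2) v
      refine continuousOn_of_le_of_ge ((isClosed_face s).preimage continuous_fst)
        (hcoord b.1).continuousOn (g := fun _ => 1 / 2) continuousOn_const ?_ ?_
      · have h1 := (continuous_coord v).comp_continuousOn
          (continuousOn_linkMap (K := X) (p := p b) (Hc b) hb hbs)
        exact (hw.continuousOn.mul continuousOn_const).add
          ((continuousOn_const.sub hw.continuousOn).mul h1)
      · refine (continuousOn_const (c := conePoint b.1 1 0 v)).congr fun q hq => ?_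
        simp only [tipWeight_eq_one hq.2]
        exact congrFun (conePoint_one _ _ _) v
  let i : C(realization Y, realization X) := ⟨fun y => ⟨y.1, realization_mono hYX y.2⟩,
    Continuous.subtype_mk continuous_subtype_val _⟩
  let re : C(realization X, realization Y) := ⟨_, hrc⟩
  let Ψe : I → C(realization X, realization X) := fun t =>
    ⟨fun x => ⟨Ψ (e x, t), hΨmem _⟩, hΨc.comp (Continuous.prodMk_left t)⟩
  have h1 : (ContinuousMap.id _).Homotopic (Ψe 0) := by
    refine homotopic_of_common_face _ _ fun x => ⟨supp x, supp_mem hX x,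
      fun v hv => notMem_supp.1 hv, fun v hv => ?_⟩
    have hex : ∀ v ∉ supp x, (e x).1 v = 0 := fun v hv => he.eq_zero (notMem_supp.1 hv)
    show Ψ (e x, 0) v = 0
    rcases hXs _ (supp_mem hX x) with hY | ⟨b, hb, hbs⟩
    · rw [hΨ0 _ (hYr _ hY (e x) hex)]
      exact hex v hv
    · rw [hΨ _ (supp_mem hX x) b hb hbs _ hex]
      have hvb : v ≠ b := fun h => hv (h ▸ hb)
      rcases le_total ((e x).1 b) (1 / 2) with h | h
      · simp only [k, conePoint]
        rw [linkMap_of_mul_eq_zero (H0 b) hb hbs hex h (zero_mul _)]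
        simp [hvb, radial, hex v hv]
      · simp [tipWeight_eq_one h, conePoint, hvb]
  have h2 : (Ψe 0).Homotopic (Ψe 1) :=
    ⟨⟨⟨fun q => ⟨Ψ (e q.2, q.1), hΨmem _⟩, hΨc.comp continuous_swap⟩, fun _ => rfl, fun _ => rfl⟩⟩
  have h3 : (Ψe 1).Homotopic (i.comp re) := by
    refine homotopic_of_common_face _ _ fun x => ?_
    show ∃ s ∈ X, (∀ v ∉ s, Ψ (e x, 1) v = 0) ∧ ∀ v ∉ s, r (e x) v = 0
    rcases hXs _ (supp_mem hX (e x)) with hY | ⟨b, hb, hbs⟩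
    · have h0 := hYr _ hY (e x) fun v hv => notMem_supp.1 hv
      refine ⟨_, supp_mem hX (e x), fun v hv => ?_, fun v hv => ?_⟩
      · rw [hΨ0 _ h0]
        exact notMem_supp.1 hv
      · rw [hr0 _ h0]
        exact notMem_supp.1 hv
    · have hx : ∀ v ∉ supp (e x), (e x).1 v = 0 := fun v hv => notMem_supp.1 hv
      rw [hΨ _ (supp_mem hX _) b hb hbs _ hx, hr _ (supp_mem hX _) b hb hbs _ hx]
      obtain ⟨-, s, hs, h, -⟩ := hk b (e x, 1)
      have h0 : ∀ v ∉ s, k b (e x, 1) v = 0 := fun v hv => by_contra fun h' => hv (h h')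
      refine ⟨_, hLX b s hs, fun v hv => ?_, fun v hv => ?_⟩
      · rw [Finset.mem_insert, not_or] at hv
        simp [conePoint, hv.1, h0 v hv.2]
      · exact h0 v fun h => hv (Finset.mem_insert_of_mem h)
  rw [contractible_iff_id_nullhomotopic]
  obtain ⟨y, hy⟩ := id_nullhomotopic (realization Y)
  refine ⟨i y, ((h1.trans h2).trans h3).trans ?_⟩
  have h4 : (i.comp ((ContinuousMap.id _).comp re)).Homotopic
      (i.comp ((ContinuousMap.const _ y).comp re)) :=
    (ContinuousMap.Homotopic.refl i).comp (hy.comp (ContinuousMap.Homotopic.refl re))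
  exact h4

end Attach

section Skeleton

variable {V : Type*}

open Classical in
lemma contractible_of_cone {K : Set (Finset V)} (hK : IsAbstractComplex K) (hne : K.Nonempty)
    (x : V) (hx : ∀ s ∈ K, insert x s ∈ K) : ContractibleSpace (realization K) := by
  obtain ⟨s, hs⟩ := hne
  have hxK : {x} ∈ K := hK.down_closed _ (hx s hs) _ (by simp) (by simp)
  let y : realization K := ⟨fun v => if v = x then 1 else 0,
    mem_realization hxK (fun v => by split_ifs <;> norm_num) (fun v hv => by simpa using hv)
      (by simp)⟩
  rw [contractible_iff_id_nullhomotopic]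
  refine ⟨y, homotopic_of_common_face _ _ fun z => ⟨_, hx _ (supp_mem hK z), fun v hv => ?_,
    fun v hv => ?_⟩⟩
  · exact notMem_supp.1 fun h => hv (Finset.mem_insert_of_mem h)
  · have hvx : v ≠ x := fun h => hv (h ▸ Finset.mem_insert_self _ _)
    simp [y, hvx]

/-- The nonempty cliques of `G` contained in `U`. -/
def cliquesIn (G : SimpleGraph V) (U : Set V) : Set (Finset V) :=
  {s | s.Nonempty ∧ G.IsClique (s : Set V) ∧ (s : Set V) ⊆ U}

variable {G : SimpleGraph V} {h : ℕ} {c : V → Fin h}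

lemma card_le_of_isClique (hcol : ∀ v w, G.Adj v w → c v ≠ c w) {C : Finset (Fin h)}
    {s : Finset V} (hs : G.IsClique (s : Set V)) (hC : ∀ v ∈ s, c v ∈ C) : s.card ≤ C.card := by
  refine Finset.card_le_card_of_injOn c hC fun v hv w hw hvw => ?_
  by_contra hne
  exact hcol v w (hs hv hw hne) hvw

lemma isAbstractComplex_cliquesIn (U : Set V) : IsAbstractComplex (cliquesIn G U) :=
  ⟨fun _ hs => hs.1, fun _ hs _ hts ht => ⟨ht, hs.2.1.subset (Finset.coe_subset.2 hts),
    (Finset.coe_subset.2 hts).trans hs.2.2⟩⟩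

lemma cliquesIn_mono {U W : Set V} (hUW : U ⊆ W) : cliquesIn G U ⊆ cliquesIn G W :=
  fun _ hs => ⟨hs.1, hs.2.1, hs.2.2.trans hUW⟩

open Classical in
lemma insert_mem_cliquesIn {U : Set V} {s : Finset V} {b : V} (hb : b ∈ U)
    (hs : s = ∅ ∨ s ∈ cliquesIn G U) (hbs : ∀ v ∈ s, v ≠ b → G.Adj b v) :
    insert b s ∈ cliquesIn G U := by
  refine ⟨Finset.insert_nonempty _ _, ?_, ?_⟩
  · rw [Finset.coe_insert, SimpleGraph.isClique_insert]
    refine ⟨?_, fun v hv hne => hbs v hv hne.symm⟩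
    rcases hs with rfl | hs
    · simp
    · exact hs.2.1
  · rw [Finset.coe_insert]
    refine insert_subset hb ?_
    rcases hs with rfl | hs
    · simp
    · exact hs.2.2

open Classical in
/-- The flag complex contains a contractible subcomplex with the full codimension-one skeleton. -/
lemma exists_contractible_skeleton (hcol : ∀ v w, G.Adj v w → c v ≠ c w) (k : ℕ) :
    ∀ (C : Finset (Fin h)) (U : Set V), C.card = k + 1 → (∀ v ∈ U, c v ∈ C) →
      (∀ i ∈ C, ∀ F : Finset V, (F : Set V) ⊆ U → (∀ v ∈ F, c v ≠ i) → F.card ≤ 2 * k →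
        ∃ v ∈ U, c v = i ∧ ∀ u ∈ F, G.Adj v u) →
      ∃ L ⊆ cliquesIn G U, IsAbstractComplex L ∧ ContractibleSpace (realization L) ∧
        ∀ s ∈ cliquesIn G U, s.card ≤ k → s ∈ L := by
  induction k with
  | zero =>
    intro C U hC hUC hQ
    obtain ⟨i, hi⟩ : C.Nonempty := Finset.card_pos.1 (by omega)
    obtain ⟨v, hv, -⟩ := hQ i hi ∅ (by simp) (by simp) (by simp)
    have hL : IsAbstractComplex ({{v}} : Set (Finset V)) := by
      refine ⟨fun s hs => ?_, fun s hs t hts ht => ?_⟩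
      · rw [mem_singleton_iff.1 hs]
        exact Finset.singleton_nonempty v
      · rw [mem_singleton_iff.1 hs] at hts
        exact (Finset.subset_singleton_iff.1 hts).resolve_left ht.ne_empty
    refine ⟨{{v}}, ?_, hL, contractible_of_cone hL (singleton_nonempty _) v ?_, ?_⟩
    · rintro s rfl
      exact ⟨by simp, by simp, by simpa using hv⟩
    · rintro s rfl
      simp
    · intro s hs h0
      exact absurd (Finset.card_pos.2 hs.1) (by omega)
  | succ k ih =>
    intro C U hC hUC hQ
    have hCne : C.Nonempty := Finset.card_pos.1 (by omega)
    obtain ⟨x, hxU, hxc, -⟩ := hQ _ (C.min'_mem hCne) ∅ (by simp) (by simp) (by simp)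
    let W : ℕ → Set V := fun t => {u | u ∈ U ∧ (u = x ∨ G.Adj x u ∨ (c u : ℕ) < t)}
    suffices H : ∀ t, ∃ L ⊆ cliquesIn G (W t), IsAbstractComplex L ∧
        ContractibleSpace (realization L) ∧ ∀ s ∈ cliquesIn G (W t), s.card ≤ k + 1 → s ∈ L by
      have hW : W h = U := by
        ext u
        exact ⟨fun hu => hu.1, fun hu => ⟨hu, Or.inr (Or.inr (c u).2)⟩⟩
      rw [← hW]
      exact H h
    intro t
    induction t with
    | zero =>
      have hx : x ∈ W 0 := ⟨hxU, Or.inl rfl⟩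
      refine ⟨_, subset_rfl, isAbstractComplex_cliquesIn _,
        contractible_of_cone (isAbstractComplex_cliquesIn _)
          ⟨{x}, by simp, by simp, by simpa using hx⟩ x fun s hs => ?_, fun s hs _ => hs⟩
      refine insert_mem_cliquesIn hx (Or.inr hs) fun v hv hne => ?_
      simpa [hne] using (hs.2.2 hv).2
    | succ t iht =>
      obtain ⟨Y, hYW, hY, hYc, hYs⟩ := iht
      have hWs : W t ⊆ W (t + 1) :=
        fun u hu => ⟨hu.1, hu.2.imp_right (Or.imp_right fun h => h.trans (Nat.lt_succ_self t))⟩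
      let B : Set V := {b | b ∈ U ∧ (c b : ℕ) = t ∧ b ≠ x ∧ ¬ G.Adj x b}
      have hBW : ∀ b ∈ B, b ∉ W t := by
        rintro b ⟨-, hbt, hbx, hbn⟩ ⟨-, h | h | h⟩
        exacts [hbx h, hbn h, by omega]
      have hBW' : ∀ b ∈ B, b ∈ W (t + 1) :=
        fun b hb => ⟨hb.1, Or.inr (Or.inr (by rw [hb.2.1]; omega))⟩
      let A : V → Set V := fun b => {u | u ∈ W t ∧ G.Adj b u}
      have hAC : ∀ b, ∀ v ∈ A b, c v ∈ C.erase (c b) := fun b v hv =>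
        Finset.mem_erase.2 ⟨(hcol b v hv.2).symm, hUC v hv.1.1⟩
      have hL : ∀ b : B, ∃ L ⊆ cliquesIn G (A b), IsAbstractComplex L ∧
          ContractibleSpace (realization L) ∧ ∀ s ∈ cliquesIn G (A b), s.card ≤ k → s ∈ L := by
        rintro ⟨b, hb⟩
        refine ih (C.erase (c b)) (A b) ?_ (hAC b) ?_
        · rw [Finset.card_erase_of_mem (hUC b hb.1), hC]
          rfl
        · intro i hi F hF hFi hFc
          obtain ⟨hib, hiC⟩ := Finset.mem_erase.1 hi
          have hFU : (F : Set V) ⊆ U := fun u hu => (hF hu).1.1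
          have hcard1 := Finset.card_insert_le b F
          have hcard2 := Finset.card_insert_le x (insert b F)
          rcases lt_or_gt_of_ne hib with hlt | hgt
          · obtain ⟨v, hvU, hvi, hv⟩ := hQ i hiC (insert b F)
              (by rw [Finset.coe_insert]; exact insert_subset hb.1 hFU)
              (fun u hu => (Finset.mem_insert.1 hu).elim (fun h => h ▸ hib.symm) (hFi u))
              (by omega)
            refine ⟨v, ⟨⟨hvU, Or.inr (Or.inr ?_)⟩, (hv b (by simp)).symm⟩, hvi,
              fun u hu => hv u (Finset.mem_insert_of_mem hu)⟩
            rw [hvi, ← hb.2.1]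
            exact hlt
          · have hxi : c x ≠ i := by
              rw [hxc]
              exact ((C.min'_le _ (hUC b hb.1)).trans_lt hgt).ne
            obtain ⟨v, hvU, hvi, hv⟩ := hQ i hiC (insert x (insert b F))
              (by
                rw [Finset.coe_insert, Finset.coe_insert]
                exact insert_subset hxU (insert_subset hb.1 hFU))
              (fun u hu => (Finset.mem_insert.1 hu).elim (fun h => h ▸ hxi) fun hu =>
                (Finset.mem_insert.1 hu).elim (fun h => h ▸ hib.symm) (hFi u))
              (by omega)
            exact ⟨v, ⟨⟨hvU, Or.inr (Or.inl (hv x (by simp)).symm)⟩, (hv b (by simp)).symm⟩, hvi,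
              fun u hu => hv u (Finset.mem_insert_of_mem (Finset.mem_insert_of_mem hu))⟩
      choose L hLA hLc hLcon hLs using hL
      have hLY : ∀ b, L b ⊆ Y := by
        intro b s hs
        have hsA := hLA b hs
        refine hYs s (cliquesIn_mono (fun u hu => hu.1) hsA) ?_
        have := card_le_of_isClique hcol hsA.2.1 fun v hv => hAC b v (hsA.2.2 hv)
        rwa [Finset.card_erase_of_mem (hUC b b.2.1), hC] at this
      let X : Set (Finset V) :=
        {s | s ∈ Y ∨ ∃ b : B, b.1 ∈ s ∧ (s.erase b = ∅ ∨ s.erase b ∈ L b)}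
      have hXW : X ⊆ cliquesIn G (W (t + 1)) := by
        rintro s (hs | ⟨b, hb, hs⟩)
        · exact cliquesIn_mono hWs (hYW hs)
        · rw [← Finset.insert_erase hb]
          refine insert_mem_cliquesIn (hBW' b b.2)
            (hs.imp_right fun h => cliquesIn_mono hWs (hYW (hLY b h))) fun v hv _ => ?_
          rcases hs with hs | hs
          · simp [hs] at hv
          · exact ((hLA b hs).2.2 hv).2
      have hX : IsAbstractComplex X := by
        refine ⟨fun s hs => (hXW hs).1, ?_⟩
        rintro s (hs | ⟨b, hb, hs⟩) t hts ht
        · exact Or.inl (hY.down_closed s hs t hts ht)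
        · have hsub : t.erase b ⊆ s.erase b := Finset.erase_subset_erase _ hts
          by_cases hbt : b.1 ∈ t
          · refine Or.inr ⟨b, hbt, ?_⟩
            rcases hs with hs | hs
            · exact Or.inl (Finset.subset_empty.1 (hs ▸ hsub))
            · exact (Finset.eq_empty_or_nonempty _).imp_right
                ((hLc b).down_closed _ hs _ hsub)
          · rw [Finset.erase_eq_of_notMem hbt] at hsub
            rcases hs with hs | hs
            · exact absurd (Finset.subset_empty.1 (hs ▸ hsub)) ht.ne_empty
            · exact Or.inl (hLY b ((hLc b).down_closed _ hs _ hsub ht))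
      refine ⟨X, hXW, hX, ?_, ?_⟩
      · refine contractible_attach hX (Y := Y) (D := (Finset.univ : Finset (Fin h)).card)
          (fun s hs => card_le_of_isClique hcol (hXW hs).2.1 fun _ _ => Finset.mem_univ _)
          (fun s hs => Or.inl hs) B L (fun s hs b hb hbs => hBW b hb ((hYW hs).2.2 hbs)) hLY
          (fun s hs => hs) (fun b s hs => Or.inr ⟨b, Finset.mem_insert_self _ _, ?_⟩) hLcon hYc
        rw [Finset.erase_insert]
        · exact Or.inr hs
        · exact fun hbs => hBW b b.2 ((hYW (hLY b hs)).2.2 hbs)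
      · intro s hs hsk
        by_cases hsW : (s : Set V) ⊆ W t
        · exact Or.inl (hYs s ⟨hs.1, hs.2.1, hsW⟩ hsk)
        · obtain ⟨b, hbs, hbW⟩ := not_subset.1 hsW
          have hbW' := hs.2.2 hbs
          have hbU : b ∈ U := hbW'.1
          simp only [W, mem_ofPred_eq, not_and, not_or] at hbW
          obtain ⟨hbx, hbn, hbt⟩ := hbW hbU
          have hb : b ∈ B := by
            refine ⟨hbU, ?_, hbx, hbn⟩
            have := (hbW'.2.resolve_left hbx).resolve_left hbn
            omega
          refine Or.inr ⟨⟨b, hb⟩, hbs, ?_⟩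
          refine (Finset.eq_empty_or_nonempty _).imp_right fun hne => hLs ⟨b, hb⟩ _
            ⟨hne, hs.2.1.subset (Finset.coe_subset.2 (Finset.erase_subset _ _)), ?_⟩ ?_
          · intro u hu
            obtain ⟨hub, hus⟩ := Finset.mem_erase.1 (Finset.mem_coe.1 hu)
            have hadj : G.Adj b u := hs.2.1 hbs hus hub.symm
            refine ⟨⟨(hs.2.2 hus).1, (hs.2.2 hus).2.imp_right (Or.imp_right fun hut => ?_)⟩, hadj⟩
            have h1 := hcol b u hadj
            have h2 : (c u : ℕ) ≠ t := fun h => h1 (Fin.ext (hb.2.1.trans h.symm))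
            omega
          · rw [Finset.card_erase_of_mem hbs]
            omega

end Skeleton

section Collapse

variable {V : Type*} {K L : Set (Finset V)}

lemma supp_mem_of_subset (hL : IsAbstractComplex L) {x : realization K} {s : Finset V}
    (hs : s ∈ L) (hx : ∀ v ∉ s, x.1 v = 0) : supp x ∈ L :=
  hL.down_closed s hs _ (supp_subset hx) (supp_nonempty x)

lemma homotopic_of_curried {Y Z : Type*} [TopologicalSpace Y] [TopologicalSpace Z]
    (F : C(Y, C(I, Z))) (f g : C(Y, Z)) (hf : ∀ y, F y 0 = f y) (hg : ∀ y, F y 1 = g y) :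
    f.Homotopic g :=
  ⟨⟨⟨fun p => F p.2 p.1, (F.continuous.comp continuous_snd).eval continuous_fst⟩, hf, hg⟩⟩

/-- The homotopy extending a contraction of `L` over the simplices outside `L`, after a clip. -/
lemma exists_extended_contraction (hK : IsAbstractComplex K) (hL : IsAbstractComplex L)
    (hLK : L ⊆ K) (hprop : ∀ s ∈ K, s ∉ L → ∀ t ⊂ s, t.Nonempty → t ∈ L)
    [ContractibleSpace (realization L)] {ε : ℝ} {e : realization K → realization K}
    (he : IsClip ε e) :
    ∃ (k : realization K × I → realization K) (p : realization K), Continuous k ∧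
      (∀ x, k (x, 0) = e (e x)) ∧ (∀ x t, supp x ∈ L → supp (k (x, t)) ∈ L) ∧
      ∀ x, supp x ∈ L → k (x, 1) = p := by
  classical
  obtain ⟨p, c, hc, hc0, hc1⟩ := exists_contraction (realization L)
  let i : realization L → realization K := fun y => ⟨y.1, realization_mono hLK y.2⟩
  have hi : Continuous i := Continuous.subtype_mk continuous_subtype_val _
  let lamAt : Finset V → realization K → I := fun s x =>
    if hs : s.Nonempty then projIcc 0 1 zero_le_one (1 - s.inf' hs x.1 / ε) else 1
  let lam : realization K → I := fun x => if supp x ∈ L then 1 else lamAt (supp x) x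
  have hlam : ∀ s ∈ K, s ∉ L → ∀ x : realization K, (∀ v ∉ s, x.1 v = 0) →
      lam x = lamAt s x := by
    intro s hs hsL x hx
    by_cases h : supp x ∈ L
    · have hne : supp x ≠ s := fun h' => hsL (h' ▸ h)
      obtain ⟨v, hvs, hv⟩ := Finset.exists_of_ssubset
        (Finset.ssubset_iff_subset_ne.2 ⟨supp_subset hx, hne⟩)
      have hsne : s.Nonempty := ⟨v, hvs⟩
      have h0 : s.inf' hsne x.1 = 0 := by
        refine le_antisymm ((Finset.inf'_le x.1 hvs).trans_eq (notMem_supp.1 hv)) ?_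
        exact Finset.le_inf' _ _ fun v _ => coord_nonneg x v
      simp only [lam, lamAt, if_pos h, dif_pos hsne, h0]
      simp
    · have hs' : supp x = s := by
        by_contra hne
        exact h (hprop s hs hsL _ (Finset.ssubset_iff_subset_ne.2 ⟨supp_subset hx, hne⟩)
          (supp_nonempty x))
      simp only [lam, if_neg h, hs']
  let g : realization K × I → realization K := fun q =>
    if h : supp (e q.1) ∈ L then i (c (⟨_, mem_realization_of_supp_mem h⟩, q.2 * lam q.1))
    else e q.1
  have hesupp : ∀ x, supp x ∈ L → supp (e x) ∈ L := fun x hx =>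
    hL.down_closed _ hx _ (he.supp_subset x) (supp_nonempty _)
  have hg : ∀ (S : Set (realization K × I)) (l : realization K × I → I), ContinuousOn l S →
      (∀ q ∈ S, supp (e q.1) ∈ L) → (∀ q ∈ S, lam q.1 = l q) → ContinuousOn g S := by
    intro S l hl h1 h2
    rw [continuousOn_iff_continuous_domRestrict] at hl ⊢
    have : Continuous fun q : S =>
        i (c (⟨_, mem_realization_of_supp_mem (h1 q q.2)⟩, q.1.2 * l q.1)) := by
      refine hi.comp (hc.comp (Continuous.prodMk ?_ ?_))
      · exact Continuous.subtype_mk (continuous_subtype_val.comp (he.continuous.comp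
          (continuous_fst.comp continuous_subtype_val))) _
      · exact (continuous_snd.comp continuous_subtype_val).mul hl
    refine this.congr fun q => ?_
    show _ = g q.1
    simp only [g]
    rw [dif_pos (h1 q q.2), h2 q q.2]
  have hgc : ∀ s ∈ K, ContinuousOn g {q | ∀ v ∉ s, q.1.1 v = 0} := by
    intro s hs
    by_cases hsL : s ∈ L
    · refine hg _ (fun _ => 1) continuousOn_const (fun q hq => ?_) fun q hq => ?_
      · exact hesupp _ (supp_mem_of_subset hL hsL hq)
      · exact if_pos (supp_mem_of_subset hL hsL hq)
    · have hsne := hK.nonempty s hs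
      have hinf : Continuous fun q : realization K × I => s.inf' hsne q.1.1 :=
        Continuous.finset_inf'_apply hsne fun v _ => (continuous_coord v).comp continuous_fst
      refine continuousOn_of_le_of_ge ((isClosed_face s).preimage continuous_fst)
        hinf.continuousOn (g := fun _ => ε) continuousOn_const ?_ ?_
      · refine hg _ (fun q => lamAt s q.1) ?_ (fun q hq => ?_) fun q hq => hlam s hs hsL _ hq.1
        · simp only [lamAt, dif_pos hsne]
          exact (continuous_projIcc.comp (continuous_const.sub (hinf.div_const ε))).continuousOn
        · obtain ⟨v, hv, hve⟩ := Finset.exists_mem_eq_inf' hsne q.1.1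
          have hle : q.1.1 v ≤ ε := hve ▸ hq.2
          refine hprop s hs hsL _ (Finset.ssubset_iff_subset_ne.2
            ⟨(he.supp_subset _).trans (supp_subset hq.1), ?_⟩) (supp_nonempty _)
          rintro rfl
          exact absurd (he.lt_of_ne_zero _ _ (mem_supp.1 hv)) hle.not_gt
      · refine (he.continuous.comp continuous_fst).continuousOn.congr fun q hq => ?_
        have h0 : lam q.1 = 0 := by
          rw [hlam s hs hsL _ hq.1]
          simp only [lamAt, dif_pos hsne]
          exact projIcc_of_le_left _ (by linarith [(one_le_div he.pos).2 hq.2])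
        simp only [g, h0, mul_zero, hc0]
        split_ifs <;> rfl
  have hLsupp : ∀ y : realization L, supp (i y) ∈ L := fun y => (supp_mem_iff hL).2 y.2
  refine ⟨fun q => g (e q.1, q.2), i p, he.continuous_comp hK hgc, fun x => ?_,
    fun x t hx => ?_, fun x hx => ?_⟩
  · simp only [g, zero_mul, hc0]
    split_ifs <;> rfl
  · simp only [g, dif_pos (hesupp _ (hesupp x hx))]
    exact hLsupp _
  · simp only [g, dif_pos (hesupp _ (hesupp x hx))]
    simp only [lam, if_pos (hesupp x hx), mul_one, hc1]

/-- A complex is homotopy equivalent to the (weak) quotient by a contractible subcomplex `L`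
containing the boundaries of all the simplices outside `L`. -/
lemma homotopyEquiv_of_collapse {V : Type} {K L : Set (Finset V)} (hK : IsAbstractComplex K)
    {D : ℕ} (hD : ∀ s ∈ K, s.card ≤ D) (hL : IsAbstractComplex L)
    (hLK : L ⊆ K) (hprop : ∀ s ∈ K, s ∉ L → ∀ t ⊂ s, t.Nonempty → t ∈ L)
    [ContractibleSpace (realization L)] {W : Type} [TopologicalSpace W]
    (q : realization K → W) (w₀ : W) (hsurj : Function.Surjective q)
    (hqL : ∀ x, supp x ∈ L → q x = w₀)
    (hqc : ∀ s ∈ K, ContinuousOn q {x | ∀ v ∉ s, x.1 v = 0})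
    (hdesc : ∀ (Z : Type) [TopologicalSpace Z] (G : realization K → Z) (z₀ : Z),
      (∀ x, supp x ∈ L → G x = z₀) →
      (∀ s ∈ K, s ∉ L → ContinuousOn G {x | ∀ v ∉ s, x.1 v = 0}) →
      ∃ g : C(W, Z), ∀ x, g (q x) = G x) :
    Nonempty (ContinuousMap.HomotopyEquiv (realization K) W) := by
  obtain ⟨ε, e, he⟩ := exists_clip hK hD
  obtain ⟨k, p, hk, hk0, hkL, hk1⟩ := exists_extended_contraction hK hL hLK hprop he
  have hesupp : ∀ x, supp x ∈ L → supp (e x) ∈ L := fun x hx =>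
    hL.down_closed _ hx _ (he.supp_subset x) (supp_nonempty _)
  have hqe : Continuous fun x => q (e x) := he.continuous_comp' hK hqc
  have he3 : ∀ (x : realization K) (s : Finset V), (∀ v ∉ s, x.1 v = 0) →
      ∀ v ∉ s, (e (e (e x))).1 v = 0 := fun x s hx v hv =>
    he.eq_zero (he.eq_zero (he.eq_zero (hx v hv)))
  let f : C(realization K, W) := ⟨_, hqe⟩
  obtain ⟨g, hg⟩ := hdesc _ (fun x => k (x, 1)) p hk1
    fun s _ _ => (hk.comp (Continuous.prodMk_left 1)).continuousOn
  let ke : I → C(realization K, realization K) := fun t =>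
    ⟨fun x => k (e x, t), hk.comp (he.continuous.prodMk continuous_const)⟩
  have hgf : (g.comp f).Homotopic (ContinuousMap.id _) := by
    have h1 : g.comp f = ke 1 := ContinuousMap.ext fun x => hg (e x)
    have h2 : (ke 0).Homotopic (ke 1) :=
      ⟨⟨⟨fun q => k (e q.2, q.1), hk.comp ((he.continuous.comp continuous_snd).prodMk
        continuous_fst)⟩, fun _ => rfl, fun _ => rfl⟩⟩
    rw [h1]
    refine h2.symm.trans (homotopic_of_common_face _ _ fun x => ⟨_, supp_mem hK x, ?_,
      fun v hv => notMem_supp.1 hv⟩)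
    intro v hv
    show (k (e x, 0)).1 v = 0
    rw [hk0]
    exact he3 x _ (fun v hv => notMem_supp.1 hv) v hv
  let Φ : C(realization K, C(I, W)) := ContinuousMap.curry ⟨fun r => q (e (k r)), hqe.comp hk⟩
  obtain ⟨F, hF⟩ := hdesc _ Φ (ContinuousMap.const _ w₀)
    (fun x hx => ContinuousMap.ext fun t => hqL _ (hesupp _ (hkL x t hx)))
    fun s _ _ => Φ.continuous.continuousOn
  have hface : ∀ x : realization K, ∀ v ∉ supp x, x.1 v = 0 := fun x v hv => notMem_supp.1 hv
  let l : realization K × I → realization K := fun r =>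
    ⟨_, segment_mem_realization (supp_mem hK r.1) (hface r.1) (he3 r.1 _ (hface r.1)) r.2⟩
  have hl : Continuous l := by
    refine continuous_to_realization fun v => ?_
    have h3 : Continuous fun r : realization K × I => r.2.1 :=
      continuous_subtype_val.comp continuous_snd
    have h1 := (continuous_coord v).comp (continuous_fst (X := realization K) (Y := I))
    have h2 := (continuous_coord v).comp
      ((he.continuous.comp (he.continuous.comp he.continuous)).comp
        (continuous_fst (X := realization K) (Y := I)))
    exact ((continuous_const.sub h3).mul h1).add (h3.mul h2)
  have hls : ∀ (x : realization K) (s : Finset V) t, (∀ v ∉ s, x.1 v = 0) →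
      ∀ v ∉ s, (l (x, t)).1 v = 0 := by
    intro x s t hx v hv
    show (1 - t.1) * x.1 v + t.1 * (e (e (e x))).1 v = 0
    rw [hx v hv, he3 x s hx v hv, mul_zero, mul_zero, add_zero]
  have hql : ∀ s ∈ K, Continuous fun r : {x : realization K | ∀ v ∉ s, x.1 v = 0} × I =>
      q (l (r.1.1, r.2)) := fun s hs =>
    (hqc s hs).comp_continuous
      (hl.comp ((continuous_subtype_val.comp continuous_fst).prodMk continuous_snd))
      fun r => hls r.1.1 s r.2 r.1.2
  let Λ : realization K → C(I, W) := fun x =>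
    ⟨fun t => q (l (x, t)), (hql _ (supp_mem hK x)).comp
      (Continuous.prodMk_right (⟨x, hface x⟩ : {x' : realization K | ∀ v ∉ supp x, x'.1 v = 0}))⟩
  obtain ⟨F', hF'⟩ := hdesc _ Λ (ContinuousMap.const _ w₀)
    (fun x hx => ContinuousMap.ext fun t =>
      hqL _ (supp_mem_of_subset hL hx (hls x _ t (hface x)))) fun s hs _ => by
    rw [continuousOn_iff_continuous_domRestrict]
    exact (ContinuousMap.curry ⟨_, hql s hs⟩).continuous
  have hfg : (f.comp g).Homotopic (ContinuousMap.id _) := by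
    let m : C(W, W) := ⟨fun w => F w 0, F.continuous.eval continuous_const⟩
    have h1 : m.Homotopic (f.comp g) := homotopic_of_curried F _ _ (fun _ => rfl) fun w => by
      obtain ⟨x, rfl⟩ := hsurj w
      rw [hF]
      exact congrArg f (hg x).symm
    have h2 : (ContinuousMap.id W).Homotopic m := by
      refine homotopic_of_curried F' _ _ (fun w => ?_) fun w => ?_
      · obtain ⟨x, rfl⟩ := hsurj w
        rw [hF']
        show q (l (x, 0)) = q x
        congr 1
        ext v
        simp [l]
      · obtain ⟨x, rfl⟩ := hsurj w
        show _ = F (q x) 0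
        rw [hF', hF]
        show q (l (x, 1)) = q (e (k (x, 0)))
        rw [hk0]
        congr 1
        ext v
        simp [l]
    exact (h2.trans h1).symm
  exact ⟨⟨f, g, hgf, hfg⟩⟩

end Collapse

section Wedge

variable {V : Type} {K L : Set (Finset V)} {n : ℕ}
  {b : Metric.sphere (0 : EuclideanSpace ℝ (Fin (n + 1))) 1}

/-- A point of a wedge of spheres lying in a given summand. -/
def wedgePoint {ι : Type} (b : Metric.sphere (0 : EuclideanSpace ℝ (Fin (n + 1))) 1) (i : ι)
    (y : Metric.sphere (0 : EuclideanSpace ℝ (Fin (n + 1))) 1) : wedgeSpheres ι n b :=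
  Quot.mk _ (Sum.inr (i, y))

/-- The base point of a wedge of spheres. -/
def wedgeBase (ι : Type) (b : Metric.sphere (0 : EuclideanSpace ℝ (Fin (n + 1))) 1) :
    wedgeSpheres ι n b :=
  Quot.mk _ (Sum.inl ())

lemma wedgePoint_self {ι : Type} (i : ι) : wedgePoint b i b = wedgeBase ι b :=
  Quot.sound ⟨rfl, trivial⟩

lemma continuous_wedgePoint {ι : Type} (i : ι) : Continuous (wedgePoint b i) := by
  let _ : TopologicalSpace ι := ⊥
  exact continuous_quot_mk.comp (continuous_inr.comp (Continuous.prodMk_right i))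

lemma wedge_cases {ι : Type} (w : wedgeSpheres ι n b) :
    w = wedgeBase ι b ∨ ∃ i y, y ≠ b ∧ w = wedgePoint b i y := by
  obtain ⟨⟨⟩ | ⟨i, y⟩, rfl⟩ := Quot.exists_rep w
  · exact Or.inl rfl
  · by_cases h : y = b
    · subst h
      exact Or.inl (wedgePoint_self i)
    · exact Or.inr ⟨i, y, h, rfl⟩

/-- Based maps on the summands induce a map on the wedge. -/
lemma exists_wedge_lift {ι Z : Type} [TopologicalSpace Z] (z₀ : Z)
    (f : ι → Metric.sphere (0 : EuclideanSpace ℝ (Fin (n + 1))) 1 → Z)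
    (hf : ∀ i, Continuous (f i)) (hb : ∀ i, f i b = z₀) :
    ∃ g : C(wedgeSpheres ι n b, Z), g (wedgeBase ι b) = z₀ ∧
      ∀ i y, g (wedgePoint b i y) = f i y := by
  let _ : TopologicalSpace ι := ⊥
  have : DiscreteTopology ι := ⟨rfl⟩
  let F : Unit ⊕ (ι × Metric.sphere (0 : EuclideanSpace ℝ (Fin (n + 1))) 1) → Z :=
    Sum.elim (fun _ => z₀) fun p => f p.1 p.2
  have hF : Continuous F :=
    continuous_const.sumElim (continuous_prod_of_discrete_left.2 hf)
  refine ⟨⟨Quot.lift F ?_, continuous_quot_lift _ hF⟩, rfl, fun _ _ => rfl⟩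
  have h : ∀ p, Sum.elim (fun _ => True)
      (fun pr : ι × Metric.sphere (0 : EuclideanSpace ℝ (Fin (n + 1))) 1 => pr.2 = b) p →
      F p = z₀ := by
    rintro (_ | ⟨i, y⟩) h
    · rfl
    · obtain rfl : y = b := h
      exact hb i
  exact fun p q hpq => (h p hpq.1).trans (h q hpq.2).symm

open Classical in
/-- The simplex spanned by `s` inside a realization, in barycentric coordinates. -/
noncomputable def cell {s : Finset V} (hs : s ∈ K) (τ : Fin (n + 1) ≃ s)
    (y : stdSimplex ℝ (Fin (n + 1))) : realization K :=
  ⟨fun v => if h : v ∈ s then y.1 (τ.symm ⟨v, h⟩) else 0, by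
    refine mem_realization hs (fun v => ?_) (fun v hv => dif_neg hv) ?_
    · split_ifs
      exacts [y.2.1 _, le_rfl]
    · rw [← Finset.sum_coe_sort s, ← y.2.2, ← τ.sum_comp]
      exact Finset.sum_congr rfl fun i _ => by simp⟩

variable {s : Finset V} {hs : s ∈ K} {τ : Fin (n + 1) ≃ s}

lemma cell_apply (y : stdSimplex ℝ (Fin (n + 1))) (i : Fin (n + 1)) :
    (cell hs τ y).1 (τ i) = y.1 i := by
  simp [cell]

lemma cell_of_notMem (y : stdSimplex ℝ (Fin (n + 1))) : ∀ v ∉ s, (cell hs τ y).1 v = 0 :=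
  fun _ hv => dif_neg hv

lemma continuous_cell : Continuous (cell (K := K) hs τ) := by
  refine continuous_to_realization fun v => ?_
  by_cases h : v ∈ s
  · simp only [cell, dif_pos h]
    exact (continuous_apply _).comp continuous_subtype_val
  · simp only [cell, dif_neg h]
    exact continuous_const

/-- Barycentric coordinates on a closed simplex. -/
noncomputable def cellCoord (τ : Fin (n + 1) ≃ s) (x : realization K) (hx : ∀ v ∉ s, x.1 v = 0) :
    stdSimplex ℝ (Fin (n + 1)) :=
  ⟨fun i => x.1 (τ i), fun i => coord_nonneg x _, by
    rw [τ.sum_comp fun v : s => x.1 v, Finset.sum_coe_sort s, sum_eq_one x.2 hx]⟩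

lemma cell_cellCoord (x : realization K) (hx : ∀ v ∉ s, x.1 v = 0) :
    cell hs τ (cellCoord τ x hx) = x := by
  refine Subtype.ext (funext fun v => ?_)
  by_cases h : v ∈ s
  · simp [cell, cellCoord, h]
  · rw [cell_of_notMem _ v h, hx v h]

lemma cellCoord_cell (y : stdSimplex ℝ (Fin (n + 1))) :
    cellCoord τ (cell hs τ y) (cell_of_notMem y) = y :=
  Subtype.ext (funext fun i => cell_apply (hs := hs) y i)

/-- The quotient of a complex by a contractible subcomplex containing the boundaries of the
remaining simplices, all of dimension `n`, is a wedge of spheres. -/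
lemma exists_homotopyEquiv_wedge (hK : IsAbstractComplex K) (hKn : ∀ s ∈ K, s.card ≤ n + 1)
    (hL : IsAbstractComplex L) (hLK : L ⊆ K) (hskel : ∀ s ∈ K, s.card ≤ n → s ∈ L)
    [ContractibleSpace (realization L)] :
    ∃ (ι : Type) (b : Metric.sphere (0 : EuclideanSpace ℝ (Fin (n + 1))) 1),
      Nonempty (ContinuousMap.HomotopyEquiv (realization K) (wedgeSpheres ι n b)) := by
  classical
  obtain ⟨b, ψ, hψ, hψb, hψs, hψi⟩ := exists_simplex_to_sphere n
  let E := {s // s ∈ K ∧ s ∉ L}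
  have hcard : ∀ s : E, s.1.card = n + 1 := fun s =>
    le_antisymm (hKn _ s.2.1) (not_le.1 fun h => s.2.2 (hskel _ s.2.1 h))
  let τ : ∀ s : E, Fin (n + 1) ≃ s.1 := fun s => (s.1.equivFinOfCardEq (hcard s)).symm
  have hprop : ∀ s ∈ K, s ∉ L → ∀ t ⊂ s, t.Nonempty → t ∈ L := fun s hs hsL t hts ht =>
    hskel t (hK.down_closed s hs t hts.1 ht)
      (Nat.lt_succ_iff.1 ((Finset.card_lt_card hts).trans_le (hKn s hs)))
  have hface : ∀ x : realization K, ∀ v ∉ supp x, x.1 v = 0 := fun x v hv => notMem_supp.1 hv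
  let q : realization K → wedgeSpheres E n b := fun x =>
    if h : supp x ∈ L then wedgeBase E b else
      wedgePoint b (⟨supp x, supp_mem hK x, h⟩ : E)
        (ψ (cellCoord (τ ⟨supp x, supp_mem hK x, h⟩) x (hface x)))
  have hqL : ∀ x, supp x ∈ L → q x = wedgeBase E b := fun x h => dif_pos h
  have hbd : ∀ (s : E) (x : realization K) (hx : ∀ v ∉ s.1, x.1 v = 0),
      ψ (cellCoord (τ s) x hx) = b ↔ supp x ∈ L := by
    intro s x hx
    rw [hψb]
    constructor
    · rintro ⟨i, hi⟩
      refine hprop s.1 s.2.1 s.2.2 _ (Finset.ssubset_iff_subset_ne.2 ⟨supp_subset hx, ?_⟩)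
        (supp_nonempty x)
      intro h
      exact mem_supp.1 (h.symm ▸ (τ s i).2) hi
    · intro h
      obtain ⟨v, hvs, hv⟩ := Finset.exists_of_ssubset (Finset.ssubset_iff_subset_ne.2
        ⟨supp_subset hx, fun h' => s.2.2 (h' ▸ h)⟩)
      exact ⟨(τ s).symm ⟨v, hvs⟩, by simpa [cellCoord] using notMem_supp.1 hv⟩
  have hqE : ∀ (s : E) (x : realization K) (hx : ∀ v ∉ s.1, x.1 v = 0),
      q x = wedgePoint b s (ψ (cellCoord (τ s) x hx)) := by
    intro s x hx
    by_cases h : supp x ∈ L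
    · rw [hqL x h, (hbd s x hx).2 h, wedgePoint_self]
    · have hs : supp x = s.1 := by
        by_contra hne
        exact h (hprop s.1 s.2.1 s.2.2 _ (Finset.ssubset_iff_subset_ne.2 ⟨supp_subset hx, hne⟩)
          (supp_nonempty x))
      obtain ⟨s, hs'⟩ := s
      obtain rfl : supp x = s := hs
      exact dif_neg h
  refine ⟨E, b, homotopyEquiv_of_collapse hK hKn hL hLK hprop q (wedgeBase E b) ?_ hqL ?_ ?_⟩
  · intro w
    rcases wedge_cases w with rfl | ⟨s, y, hy, rfl⟩
    · obtain ⟨y⟩ : Nonempty (realization L) := inferInstance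
      exact ⟨⟨y.1, realization_mono hLK y.2⟩, hqL _ ((supp_mem_iff hL).2 y.2)⟩
    · obtain ⟨z, rfl⟩ := hψs y hy
      exact ⟨cell s.2.1 (τ s) z, by rw [hqE s _ (cell_of_notMem z), cellCoord_cell]⟩
  · intro s hs
    by_cases hsL : s ∈ L
    · exact continuousOn_const.congr fun x hx => hqL x (supp_mem_of_subset hL hsL hx)
    · rw [continuousOn_iff_continuous_domRestrict]
      have : Continuous fun x : {x : realization K | ∀ v ∉ s, x.1 v = 0} =>
          wedgePoint b (⟨s, hs, hsL⟩ : E) (ψ (cellCoord (τ ⟨s, hs, hsL⟩) x.1 x.2)) := by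
        refine (continuous_wedgePoint _).comp (hψ.comp (Continuous.subtype_mk
          (continuous_pi fun i => ?_) _))
        exact (continuous_coord _).comp continuous_subtype_val
      exact this.congr fun x => (hqE ⟨s, hs, hsL⟩ x.1 x.2).symm
  · intro Z _ G z₀ hGL hGc
    have hlift : ∀ s : E, ∃ f : Metric.sphere (0 : EuclideanSpace ℝ (Fin (n + 1))) 1 → Z,
        Continuous f ∧ f b = z₀ ∧ ∀ y, f (ψ y) = G (cell s.2.1 (τ s) y) := by
      intro s
      have hGb : ∀ y, ψ y = b → G (cell s.2.1 (τ s) y) = z₀ := fun y hy => hGL _ <| by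
        rw [← hbd s _ (cell_of_notMem y), cellCoord_cell, hy]
      let f : Metric.sphere (0 : EuclideanSpace ℝ (Fin (n + 1))) 1 → Z := fun y =>
        if h : y ≠ b then G (cell s.2.1 (τ s) (hψs y h).choose) else z₀
      have hfψ : ∀ y, f (ψ y) = G (cell s.2.1 (τ s) y) := by
        intro y
        by_cases h : ψ y = b
        · rw [hGb y h]
          exact dif_neg (not_not.2 h)
        · have h1 := (hψs (ψ y) h).choose_spec
          have h2 := hψi _ _ h1 (by rwa [h1])
          simp only [f, dif_pos (show ψ y ≠ b from h), h2]
      have hfb : f b = z₀ := dif_neg (not_not.2 rfl)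
      refine ⟨f, ?_, hfb, hfψ⟩
      let π : stdSimplex ℝ (Fin (n + 1)) ⊕ Unit →
          Metric.sphere (0 : EuclideanSpace ℝ (Fin (n + 1))) 1 := Sum.elim ψ fun _ => b
      have hπ : IsQuotientMap π := by
        refine IsQuotientMap.of_surjective_continuous (fun y => ?_) (hψ.sumElim continuous_const)
        by_cases h : y = b
        · exact ⟨Sum.inr (), h.symm⟩
        · obtain ⟨z, hz⟩ := hψs y h
          exact ⟨Sum.inl z, hz⟩
      rw [hπ.continuous_iff]
      refine continuous_sum_dom.2 ⟨?_, ?_⟩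
      · exact ((hGc s.1 s.2.1 s.2.2).comp_continuous continuous_cell cell_of_notMem).congr
          fun y => (hfψ y).symm
      · exact (continuous_const : Continuous fun _ : Unit => f b)
    choose f hfc hfb hfψ using hlift
    obtain ⟨g, hg0, hg⟩ := exists_wedge_lift z₀ f hfc hfb
    refine ⟨g, fun x => ?_⟩
    by_cases h : supp x ∈ L
    · rw [hqL x h, hg0, hGL x h]
    · rw [hqE ⟨supp x, supp_mem hK x, h⟩ x (hface x), hg, hfψ, cell_cellCoord]

end Wedge

end Realization

/-- the flag complex of an `h`-colored graph satisfying the two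
connectivity conditions is homotopy equivalent to a wedge of `(h-1)`-spheres. -/
theorem stmt18 {V : Type} (G : SimpleGraph V) (h : ℕ) (hpos : 0 < h) (c : V → Fin h)
    (hcol : ∀ v w, G.Adj v w → c v ≠ c w)
    (h1 : ∀ i : Fin h, ∃ v w, v ≠ w ∧ c v = i ∧ c w = i)
    (h2 : ∀ i : Fin h, ∀ u : Fin (2 * (h - 1)) → V, (∀ j, c (u j) ≠ i) →
      ∃ v w, v ≠ w ∧ c v = i ∧ c w = i ∧ ∀ j, G.Adj v (u j) ∧ G.Adj w (u j)) :
    ∃ (ι : Type) (b : Metric.sphere (0 : EuclideanSpace ℝ (Fin (h - 1 + 1))) 1),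
      Nonempty (ContinuousMap.HomotopyEquiv
        ↥(realization (cliqueComplex G)) (wedgeSpheres ι (h - 1) b)) := by
  classical
  have hcard : (Finset.univ : Finset (Fin h)).card = h - 1 + 1 := by
    rw [Finset.card_univ, Fintype.card_fin]
    omega
  have huniv : cliquesIn G Set.univ = cliqueComplex G := by
    ext s
    simp [cliquesIn, cliqueComplex]
  obtain ⟨L, hLK, hL, hLc, hLs⟩ := exists_contractible_skeleton hcol (h - 1) Finset.univ Set.univ
    hcard (fun _ _ => Finset.mem_univ _) fun i _ F _ hFi hFc => by
      rcases F.eq_empty_or_nonempty with rfl | ⟨u₀, hu₀⟩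
      · obtain ⟨v, -, -, hv, -⟩ := h1 i
        exact ⟨v, Set.mem_univ v, hv, by simp⟩
      · let u : Fin (2 * (h - 1)) → V := fun j =>
          if hj : j.1 < F.card then F.equivFin.symm ⟨j, hj⟩ else u₀
        have hu : ∀ j, u j ∈ F := fun j => by
          by_cases hj : j.1 < F.card
          · simp only [u, dif_pos hj]
            exact (F.equivFin.symm ⟨j, hj⟩).2
          · simpa only [u, dif_neg hj] using hu₀
        obtain ⟨v, w', -, hv, -, hadj⟩ := h2 i u fun j => hFi _ (hu j)
        refine ⟨v, Set.mem_univ v, hv, fun w hw => ?_⟩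
        have hlt := (F.equivFin ⟨w, hw⟩).2
        have := (hadj ⟨F.equivFin ⟨w, hw⟩, hlt.trans_le hFc⟩).1
        simpa [u] using this
  rw [huniv] at hLK hLs
  exact exists_homotopyEquiv_wedge (huniv ▸ isAbstractComplex_cliquesIn Set.univ)
    (fun s hs => (card_le_of_isClique hcol hs.2 fun _ _ => Finset.mem_univ _).trans hcard.le)
    hL hLK hLs

end PeiPaper
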